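/- (Isometry property of the Wigner transform on the hyperbolic disc.) Let a : 𝔻 × S¹ × ℝ → ℂ be smooth and compactly supported, and assume the Weyl symmetry: for all z, w ∈ 𝔻 and r ∈ ℝ, ∫_{S¹} a(z,b,r) P(z,b)^{1/2+ir} P(w,b)^{1/2−ir} db = ∫_{S¹} a(z,b,−r) P(z,b)^{1/2−ir} P(w,b)^{1/2+ir} db. Define the Wigner transform 𝒲a(r, b, r', b') = ∫_𝔻 a(z,b,r) P(z,b)^{1/2+ir} P(z,b')^{1/2+ir'} Vol(dz). Then ∫_𝔻 ∫_{S¹} ∫_0^∞ |a(z,b,r)|² P(z,b) (2π)^{−1} r·tanh(πr) Vol(dz) db dr = ∫_{S¹} ∫_0^∞ ∫_{S¹} ∫_0^∞ |𝒲a(r, b, r', b')|² (2π)^{−1} r·tanh(πr) (2π)^{−1} r'·tanh(πr') db dr db' dr'. -/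

import Mathlib

open Complex MeasureTheory Real

noncomputable section

/-- Poisson kernel on 𝔻 × S¹. -/
def Pk (z b : ℂ) : ℝ := (1 - ‖z‖ ^ 2) / ‖z - b‖ ^ 2

/-- Normalized arclength (probability) measure on the unit circle S¹ ⊆ ℂ. -/
def circleMeasure : Measure ℂ :=
  (ENNReal.ofReal (2 * Real.pi))⁻¹ •
    (volume.restrict (Set.Ioc (0 : ℝ) (2 * Real.pi))).map
      (fun θ : ℝ => Complex.exp ((θ : ℂ) * Complex.I))

/-- Hyperbolic area measure on the unit disc 𝔻. -/
def hypVol : Measure ℂ :=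
  (volume.restrict (Metric.ball (0 : ℂ) 1)).withDensity
    (fun z => ENNReal.ofReal (4 / (1 - ‖z‖ ^ 2) ^ 2))

lemma hasSum_two_mul_div_sq_add_sq {r : ℝ} (hr : r ≠ 0) :
    HasSum (fun n : ℕ => 2 * r / (r ^ 2 + (n + 1 : ℝ) ^ 2))
      (Real.pi * (Real.cosh (Real.pi * r) / Real.sinh (Real.pi * r)) - 1 / r) := by
  have hx : (I * r : ℂ) ∈ integerComplement := by
    rintro ⟨n, hn⟩
    have := congrArg Complex.im hn
    simp at this
    exact hr this.symm
  have hs : HasSum (fun n : ℕ => cotTerm (I * r) n) _ := (summable_cotTerm hx).hasSum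
  have h2 : ∑' n : ℕ, cotTerm (I * r) n = _ := (cot_series_rep' hx).symm
  rw [h2] at hs
  have h3 := hs.mul_left I
  have hsinh : Complex.sinh (Real.pi * r) ≠ 0 := by
    rw [← Complex.ofReal_mul, ← Complex.ofReal_sinh, Complex.ofReal_ne_zero, Ne, Real.sinh_eq_zero]
    exact mul_ne_zero Real.pi_ne_zero hr
  have hrC : (r : ℂ) ≠ 0 := by exact_mod_cast hr
  rw [← Complex.hasSum_ofReal]
  convert! h3 using 1
  · ext n
    rw [cotTerm_identity hx]
    have e : ((I * r + (n + 1)) * (I * r - (n + 1)) : ℂ) = -(r ^ 2 + (n + 1) ^ 2) := by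
      linear_combination (r : ℂ) ^ 2 * I_sq
    rw [e]
    push_cast
    rw [one_div, inv_neg, div_eq_mul_inv]
    linear_combination (2 * r * (r ^ 2 + (n + 1) ^ 2 : ℂ)⁻¹) * I_sq
  · have e : (Real.pi * (I * r) : ℂ) = (Real.pi * r : ℂ) * I := by ring
    rw [e, Complex.cot, Complex.cos_mul_I, Complex.sin_mul_I]
    push_cast
    field_simp

lemma hasSum_tanh {r : ℝ} (hr : r ≠ 0) :
    HasSum (fun n : ℕ => 2 * r / (r ^ 2 + (n + 1 / 2 : ℝ) ^ 2))
      (Real.pi * Real.tanh (Real.pi * r)) := by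
  have h1 := hasSum_two_mul_div_sq_add_sq hr
  have h2 := (hasSum_two_mul_div_sq_add_sq (mul_ne_zero two_ne_zero hr)).mul_left 2
  set g : ℕ → ℝ := fun n => 2 * (2 * (2 * r) / ((2 * r) ^ 2 + ((n : ℝ) + 1) ^ 2)) with hg
  have hev : (fun n : ℕ => g (2 * n + 1)) = fun n : ℕ => 2 * r / (r ^ 2 + (n + 1 : ℝ) ^ 2) := by
    ext n
    simp only [hg]
    push_cast
    have : r ^ 2 + (n + 1 : ℝ) ^ 2 ≠ 0 := by positivity
    rw [show (2 * r) ^ 2 + (2 * (n : ℝ) + 1 + 1) ^ 2 = 4 * (r ^ 2 + (n + 1 : ℝ) ^ 2) by ring]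
    field_simp
    norm_num
  have hodd : (fun n : ℕ => g (2 * n)) = fun n : ℕ => 2 * r / (r ^ 2 + (n + 1 / 2 : ℝ) ^ 2) := by
    ext n
    simp only [hg]
    push_cast
    have : r ^ 2 + (n + 1 / 2 : ℝ) ^ 2 ≠ 0 := by positivity
    rw [show (2 * r) ^ 2 + (2 * (n : ℝ) + 1) ^ 2 = 4 * (r ^ 2 + (n + 1 / 2 : ℝ) ^ 2) by ring]
    rw [mul_div_assoc', div_eq_div_iff (by positivity) this]
    ring
  have hs : Summable fun n : ℕ => g (2 * n) :=
    h2.summable.comp_injective (i := fun n : ℕ => 2 * n) (fun a b h => by simpa using h)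
  rw [← hev] at h1
  have h3 := (hs.hasSum.even_add_odd h1).unique h2
  have h4 := hs.hasSum
  rw [eq_sub_of_add_eq h3, hodd] at h4
  convert! h4 using 1
  have hs : Real.sinh (Real.pi * r) ≠ 0 := by
    rw [Ne, Real.sinh_eq_zero]; exact mul_ne_zero Real.pi_ne_zero hr
  have hc : Real.cosh (Real.pi * r) ≠ 0 := (Real.cosh_pos _).ne'
  rw [show Real.pi * (2 * r) = 2 * (Real.pi * r) by ring, Real.cosh_two_mul, Real.sinh_two_mul,
    Real.tanh_eq_sinh_div_cosh]
  field_simp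
  ring

lemma integral_Ioi_sin_div_sinh (r : ℝ) :
    ∫ t in Set.Ioi (0 : ℝ), Real.sin (r * t) / Real.sinh (t / 2) =
      Real.pi * Real.tanh (Real.pi * r) := by
  rcases eq_or_ne r 0 with rfl | hr
  · simp
  have hc (n : ℕ) : (0 : ℝ) < n + 1 / 2 := by positivity
  have hint (n : ℕ) : IntegrableOn
      (fun t : ℝ => cexp ((-(n + 1 / 2 : ℝ) + r * I) * t)) (Set.Ioi 0) :=
    integrableOn_exp_mul_complex_Ioi (by simpa [neg_lt_iff_pos_add] using hc n) 0
  have hF (n : ℕ) (t : ℝ) : 2 * (Real.sin (r * t) * Real.exp (-(n + 1 / 2) * t)) =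
      2 * (cexp ((-(n + 1 / 2 : ℝ) + r * I) * t)).im := by
    rw [Complex.exp_im]
    simp
    ring
  have hI (n : ℕ) : ∫ t in Set.Ioi (0 : ℝ), 2 * (Real.sin (r * t) * Real.exp (-(n + 1 / 2) * t)) =
      2 * r / (r ^ 2 + (n + 1 / 2 : ℝ) ^ 2) := by
    simp_rw [hF]
    rw [integral_const_mul]
    have := integral_im (hint n)
    simp only [RCLike.im_to_complex] at this
    rw [this, integral_exp_mul_complex_Ioi (by simpa [neg_lt_iff_pos_add] using hc n)]
    have h0 : r ^ 2 + (n + 1 / 2 : ℝ) ^ 2 ≠ 0 := by positivity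
    simp [Complex.div_im, Complex.normSq_apply]
    field_simp
    ring
  have hgI (n : ℕ) : IntegrableOn (fun t : ℝ => t ^ ((2 : ℝ) - 1) * Real.exp (-((n + 1 / 2) * t)))
      (Set.Ioi 0) := by
    by_contra h
    have h1 := Real.integral_rpow_mul_exp_neg_mul_Ioi (a := 2) two_pos (hc n)
    rw [integral_undef h] at h1
    have : 0 < (1 / (n + 1 / 2 : ℝ)) ^ (2 : ℝ) * Real.Gamma 2 := by
      have := Real.Gamma_pos_of_pos (two_pos (α := ℝ))
      have := hc n
      positivity
    linarith
  have hb (n : ℕ) : ∫ t in Set.Ioi (0 : ℝ), ‖2 * (Real.sin (r * t) * Real.exp (-(n + 1 / 2) * t))‖ ≤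
      2 * |r| * (1 / (n + 1 / 2 : ℝ)) ^ (2 : ℝ) := by
    have h1 := Real.integral_rpow_mul_exp_neg_mul_Ioi (a := 2) two_pos (hc n)
    rw [Real.Gamma_two, mul_one] at h1
    rw [← h1, ← integral_const_mul]
    refine setIntegral_mono_on ?_ ((hgI n).const_mul _) measurableSet_Ioi ?_
    · simp_rw [hF]
      exact ((hint n).im.const_mul 2).norm
    · intro t ht
      have ht : 0 < t := ht
      have : |Real.sin (r * t)| ≤ |r| * t := by
        simpa [abs_mul, abs_of_pos ht] using (Real.abs_sin_le_abs (x := r * t))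
      have h2 := mul_le_mul_of_nonneg_right this (Real.exp_pos (-(n + 1 / 2) * t)).le
      rw [Real.norm_eq_abs, abs_mul, abs_mul, abs_two, Real.abs_exp, show (2 : ℝ) - 1 = 1 by norm_num,
        Real.rpow_one, ← neg_mul]
      linarith
  have hsum : Summable fun n : ℕ =>
      ∫ t in Set.Ioi (0 : ℝ), ‖2 * (Real.sin (r * t) * Real.exp (-(n + 1 / 2) * t))‖ := by
    refine Summable.of_nonneg_of_le (fun n => integral_nonneg fun _ => norm_nonneg _) hb ?_
    refine Summable.mul_left _ ?_
    have h1 := (hasSum_tanh (one_ne_zero)).summable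
    refine Summable.of_nonneg_of_le (fun n => by positivity) (fun n => ?_) (h1.mul_left (5 / 2))
    rw [Real.rpow_two, div_pow, one_pow, ← mul_div_assoc, div_le_div_iff₀ (by positivity) (by positivity)]
    have : (0 : ℝ) ≤ n := n.cast_nonneg
    nlinarith
  have key := hasSum_integral_of_summable_integral_norm (μ := volume.restrict (Set.Ioi (0 : ℝ)))
    (F := fun (n : ℕ) t => 2 * (Real.sin (r * t) * Real.exp (-(n + 1 / 2) * t)))
    (fun n => by simp_rw [hF]; exact (hint n).im.const_mul 2) hsum
  simp_rw [hI] at key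
  rw [(hasSum_tanh hr).unique key]
  refine setIntegral_congr_fun measurableSet_Ioi fun t ht => ?_
  have ht : 0 < t := ht
  have h1 : Real.exp (-t) < 1 := by simpa using ht
  have h2 := (hasSum_geometric_of_lt_one (Real.exp_pos (-t)).le h1).mul_left
    (2 * Real.sin (r * t) * Real.exp (-(t / 2)))
  have h3 : HasSum (fun n : ℕ => 2 * (Real.sin (r * t) * Real.exp (-(n + 1 / 2) * t)))
      (2 * Real.sin (r * t) * Real.exp (-(t / 2)) * (1 - Real.exp (-t))⁻¹) := by
    convert! h2 using 2 with n
    rw [← Real.exp_nat_mul, mul_assoc, mul_assoc, ← Real.exp_add]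
    ring_nf
  rw [h3.tsum_eq, Real.sinh_eq]
  have h4 : Real.exp (-t) = Real.exp (-(t/2)) * Real.exp (-(t / 2)) := by
    rw [← Real.exp_add]; ring_nf
  have h5 : Real.exp (t / 2) * Real.exp (-(t / 2)) = 1 := by rw [← Real.exp_add]; simp
  have h7 : (Real.exp (t / 2) - Real.exp (-(t / 2))) / 2 ≠ 0 := by
    have : Real.exp (-(t / 2)) < Real.exp (t / 2) := Real.exp_lt_exp.2 (by linarith)
    linarith
  rw [div_eq_iff h7, h4] 
  have h8 : Real.exp (t / 2) - Real.exp (-(t / 2)) ≠ 0 := fun h => h7 (by rw [h, zero_div])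
  have h9 : 1 - Real.exp (-(t / 2)) * Real.exp (-(t / 2)) =
      Real.exp (-(t / 2)) * (Real.exp (t / 2) - Real.exp (-(t / 2))) := by
    linear_combination -h5
  rw [h9]
  have := (Real.exp_pos (-(t / 2))).ne'
  field_simp

open scoped FourierTransform SchwartzMap in
lemma integrable_pow_mul_norm_expTransform {A : ℝ → ℂ} (hA : ContDiff ℝ (⊤ : ℕ∞) A)
    (hc : HasCompactSupport A) (k : ℕ) :
    Integrable fun r : ℝ => |r| ^ k * ‖∫ t : ℝ, cexp (I * r * t) * A t‖ := by
  have h := (𝓕 (hc.toSchwartzMap hA)).integrable_pow_mul volume k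
  have h2 := (h.comp_mul_left' (R := -(2 * Real.pi)⁻¹) (by simp [Real.pi_ne_zero])).const_mul
    ((2 * Real.pi) ^ k)
  refine h2.congr (Filter.Eventually.of_forall fun r => ?_)
  simp only [Real.norm_eq_abs, SchwartzMap.fourier_coe, Real.fourier_real_eq_integral_exp_smul,
    HasCompactSupport.toSchwartzMap_toFun, smul_eq_mul, abs_mul _ r, abs_neg, abs_inv, mul_pow _ |r|]
  rw [abs_of_pos Real.two_pi_pos, ← mul_assoc, ← mul_assoc, inv_pow, mul_inv_cancel₀ (by positivity),
    one_mul]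
  congr 2
  refine integral_congr_ae (Filter.Eventually.of_forall fun t => ?_)
  have : (Real.pi : ℂ) ≠ 0 := by exact_mod_cast Real.pi_ne_zero
  change cexp _ * A t = _
  congr 2
  push_cast
  field_simp

lemma expTransform_neg {A : ℝ → ℂ} (heven : ∀ t, A (-t) = A t) (r : ℝ) :
    ∫ t : ℝ, cexp (I * (-r : ℝ) * t) * A t = ∫ t : ℝ, cexp (I * r * t) * A t := by
  rw [← integral_neg_eq_self]
  simp [heven]

open scoped FourierTransform SchwartzMap in
lemma neg_deriv_eq_integral {A : ℝ → ℂ} (hA : ContDiff ℝ (⊤ : ℕ∞) A)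
    (hc : HasCompactSupport A) (heven : ∀ t, A (-t) = A t) (t : ℝ) :
    -deriv A t = (Real.pi : ℂ)⁻¹ * ∫ r in Set.Ioi (0 : ℝ),
      r * Real.sin (r * t) * ∫ u : ℝ, cexp (I * r * u) * A u := by
  set S := hc.toSchwartzMap hA with hS
  set T : ℝ → ℂ := fun r => ∫ u : ℝ, cexp (I * r * u) * A u with hT
  have hTn (r : ℝ) : T (-r) = T r := expTransform_neg heven r
  have hpi : (Real.pi : ℂ) ≠ 0 := by exact_mod_cast Real.pi_ne_zero
  have hFA (x : ℝ) : 𝓕 A x = T (2 * Real.pi * x) := by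
    rw [← hTn, Real.fourier_real_eq_integral_exp_smul]
    refine integral_congr_ae (Filter.Eventually.of_forall fun t => ?_)
    simp only [smul_eq_mul]
    congr 2
    push_cast
    ring
  have hdiff : Differentiable ℝ A := hA.differentiable (by simp)
  have hFd : 𝓕 (deriv A) = fun (x : ℝ) ↦ (2 * Real.pi * I * x) • T (2 * Real.pi * x) := by
    simp_rw [← hFA]
    exact Real.fourier_deriv (hA.continuous.integrable_of_hasCompactSupport hc) hdiff
      ((hA.continuous_deriv (by simp)).integrable_of_hasCompactSupport hc.deriv)
  have hd := hc.deriv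
  have hdA : ContDiff ℝ (⊤ : ℕ∞) (deriv A) :=  by
    exact (contDiff_infty_iff_deriv.1 hA).2
  have hinv : 𝓕⁻ (𝓕 (deriv A)) t = deriv A t := by
    have h1 : Integrable (deriv A) := hdA.continuous.integrable_of_hasCompactSupport hd
    have h2 : Integrable (𝓕 (deriv A)) := (𝓕 (hd.toSchwartzMap hdA)).integrable
    exact h1.fourierInv_fourier_eq h2 hdA.continuous.continuousAt
  have hi : Integrable (fun x : ℝ => cexp ((2 * Real.pi * x * t : ℝ) * I) * ((2 * Real.pi * I * x) • T (2 * Real.pi * x))) := by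
    have h2 : Integrable (𝓕 (deriv A)) := (𝓕 (hd.toSchwartzMap hdA)).integrable
    rw [hFd] at h2
    refine h2.bdd_mul (c := 1) (by fun_prop) (Filter.Eventually.of_forall fun x => ?_)
    rw [Complex.norm_exp_ofReal_mul_I]
  have e1 : deriv A t = ∫ x : ℝ, cexp ((2 * Real.pi * x * t : ℝ) * I) * ((2 * Real.pi * I * x) • T (2 * Real.pi * x)) := by
    rw [← hinv, Real.fourierInv_eq', hFd]
    refine integral_congr_ae (Filter.Eventually.of_forall fun x => ?_)
    simp only [smul_eq_mul, RCLike.inner_apply, conj_trivial]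
    congr 3
    push_cast
    ring
  have e2 : deriv A t = ∫ x : ℝ, cexp ((2 * Real.pi * (-x) * t : ℝ) * I) * ((2 * Real.pi * I * (-x : ℝ)) • T (2 * Real.pi * (-x))) := by
    rw [e1]
    exact (integral_neg_eq_self _ _).symm
  have hi' := hi.comp_neg
  have e3 : 2 * deriv A t = ∫ x : ℝ, (fun y : ℝ => -2 * (y * Real.sin (y * t) * T y)) (2 * Real.pi * x) := by
    have : 2 * deriv A t = deriv A t + deriv A t := by ring
    rw [this]
    nth_rewrite 1 [e1]
    rw [e2, ← integral_add hi hi']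
    refine integral_congr_ae (Filter.Eventually.of_forall fun x => ?_)
    simp only [smul_eq_mul, mul_neg, hTn]
    push_cast
    rw [show (-(2 * Real.pi * x) * t * I : ℂ) = (-(2 * Real.pi * x * t)) * I by ring,
      Complex.exp_mul_I, Complex.exp_mul_I, Complex.cos_neg, Complex.sin_neg]
    linear_combination (4 * Real.pi * x * T (2 * Real.pi * x) * Complex.sin (2 * Real.pi * x * t)) * I_sq
  rw [Measure.integral_comp_mul_left (fun y : ℝ => -2 * (y * Real.sin (y * t) * T y))] at e3
  have e4 : ∫ y : ℝ, -2 * (y * Real.sin (y * t) * T y) =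
      2 * ∫ y in Set.Ioi (0 : ℝ), -2 * (y * Real.sin (y * t) * T y) := by
    have h1 : ∫ y in Set.Iic (0:ℝ), -2 * (y * Real.sin (y * t) * T y) =
        ∫ y in Set.Ioi (0:ℝ), -2 * (y * Real.sin (y * t) * T y) := by
      have := integral_comp_neg_Ioi 0 (fun y : ℝ => -2 * (y * Real.sin (y * t) * T y))
      rw [neg_zero] at this
      rw [← this]
      simp [hTn]
    have hI : Integrable fun y : ℝ => -2 * (y * Real.sin (y * t) * T y) := by
      have hTc : Continuous T := by
        have : T = fun x => 𝓕 S (x * (2 * Real.pi)⁻¹) := by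
          ext x
          rw [SchwartzMap.fourier_coe, hS, show (⇑(hc.toSchwartzMap hA) : ℝ → ℂ) = A from rfl, hFA]
          congr 1
          field_simp
        rw [this]
        exact (𝓕 S).continuous.comp (by fun_prop)
      refine (((integrable_pow_mul_norm_expTransform hA hc 1).const_mul 2)).mono' (by fun_prop)
        (Filter.Eventually.of_forall fun y => ?_)
      simp only [norm_mul, norm_neg, Complex.norm_real, Real.norm_eq_abs, pow_one, Complex.norm_ofNat]
      have := Real.abs_sin_le_one (y * t)
      have h3 : 0 ≤ |y| * ‖T y‖ := by positivity
      nlinarith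
    rw [← intervalIntegral.integral_Iic_add_Ioi hI.integrableOn hI.integrableOn, h1]
    ring
  rw [e4, integral_const_mul] at e3
  rw [abs_of_pos (by positivity), Complex.real_smul] at e3
  push_cast at e3
  have e5 : -deriv A t = (2 * Real.pi : ℂ)⁻¹ * (2 * ∫ y in Set.Ioi (0 : ℝ), (y * Real.sin (y * t) * T y)) := by
    push_cast
    linear_combination (-1 / 2 : ℂ) * e3
  rw [e5, mul_inv, ← mul_assoc, mul_right_comm _ _ (2 : ℂ), inv_mul_cancel₀ two_ne_zero, one_mul]

lemma abs_sin_div_sinh_le {r t : ℝ} (ht : 0 < t) :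
    |Real.sin (r * t) / Real.sinh (t / 2)| ≤ |r| * (4 * Real.exp (-(1 / 4) * t)) := by
  have h1 : Real.sinh (t / 2) = 2 * Real.sinh (t / 4) * Real.cosh (t / 4) := by
    rw [← Real.sinh_two_mul]; ring_nf
  have h2 : t / 4 ≤ Real.sinh (t / 4) := Real.self_le_sinh_iff.2 (by linarith)
  have h3 : Real.exp (t / 4) / 2 ≤ Real.cosh (t / 4) := by
    rw [Real.cosh_eq]
    have := Real.exp_pos (-(t / 4))
    linarith
  have h4 : t / 4 * Real.exp (t / 4) ≤ Real.sinh (t / 2) := by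
    rw [h1]
    have := mul_le_mul h2 h3 (by positivity) (by linarith)
    linarith
  have h0 : 0 < Real.sinh (t / 2) := Real.sinh_pos_iff.2 (by linarith)
  rw [abs_div, abs_of_pos h0, div_le_iff₀ h0]
  have h5 : |Real.sin (r * t)| ≤ |r| * t := by
    simpa [abs_mul, abs_of_pos ht] using (Real.abs_sin_le_abs (x := r * t))
  have h6 : Real.exp (-(1 / 4) * t) * Real.exp (t / 4) = 1 := by
    rw [← Real.exp_add]; ring_nf; simp
  have h7 := mul_le_mul_of_nonneg_left h4 (by positivity : 0 ≤ |r| * (4 * Real.exp (-(1 / 4) * t)))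
  have h8 : |r| * (4 * Real.exp (-(1 / 4) * t)) * (t / 4 * Real.exp (t / 4)) = |r| * t := by
    linear_combination |r| * t * h6
  linarith

lemma continuous_expTransform {A : ℝ → ℂ} (hA : Continuous A)
    (hc : HasCompactSupport A) : Continuous fun r : ℝ => ∫ t : ℝ, cexp (I * r * t) * A t := by
  refine continuous_of_dominated (bound := fun t => ‖A t‖) (fun r => by fun_prop) (fun r => ?_)
    (hA.integrable_of_hasCompactSupport hc).norm ?_
  · refine Filter.Eventually.of_forall fun t => ?_
    rw [norm_mul, show (I * r * t : ℂ) = (r * t : ℝ) * I by push_cast; ring,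
      Complex.norm_exp_ofReal_mul_I, one_mul]
  · exact Filter.Eventually.of_forall fun t => by fun_prop

lemma plancherel_density_integral {A : ℝ → ℂ} (hA : ContDiff ℝ (⊤ : ℕ∞) A)
    (hc : HasCompactSupport A) (heven : ∀ t, A (-t) = A t) :
    ∫ r in Set.Ioi (0 : ℝ), (∫ t : ℝ, cexp (I * r * t) * A t) *
        ((2 * Real.pi)⁻¹ * r * Real.tanh (Real.pi * r) : ℝ) =
      (2 * Real.pi : ℂ)⁻¹ * ∫ t in Set.Ioi (0 : ℝ), -deriv A t / Real.sinh (t / 2) := by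
  set T : ℝ → ℂ := fun r => ∫ u : ℝ, cexp (I * r * u) * A u with hT
  have hpi : (Real.pi : ℂ) ≠ 0 := by exact_mod_cast Real.pi_ne_zero
  have hTc : Continuous T := continuous_expTransform hA.continuous hc
  have hI : Integrable (Function.uncurry fun r t : ℝ =>
      r * T r * (Real.sin (r * t) / Real.sinh (t / 2) : ℝ))
      ((volume.restrict (Set.Ioi 0)).prod (volume.restrict (Set.Ioi 0))) := by
    have h1 : IntegrableOn (fun t : ℝ => 4 * Real.exp (-(1 / 4) * t)) (Set.Ioi 0) :=
      (integrableOn_exp_mul_Ioi (by norm_num) 0).const_mul 4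
    have h2 := (integrable_pow_mul_norm_expTransform hA hc 2).integrableOn (s := Set.Ioi 0)
    refine (h2.mul_prod h1).mono' ?_ ?_
    · refine Measurable.aestronglyMeasurable ?_
      have := hTc.measurable
      unfold Function.uncurry
      have h3 : Measurable Real.sinh := Real.continuous_sinh.measurable
      fun_prop
    · rw [Measure.prod_restrict]
      refine (ae_restrict_iff' (measurableSet_Ioi.prod measurableSet_Ioi)).2
        (Filter.Eventually.of_forall fun p hp => ?_)
      have := abs_sin_div_sinh_le (r := p.1) (t := p.2) hp.2
      simp only [Function.uncurry, norm_mul, Complex.norm_real, Real.norm_eq_abs]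
      have h3 := mul_le_mul_of_nonneg_left this (by positivity : 0 ≤ |p.1| * ‖T p.1‖)
      refine h3.trans_eq ?_
      ring
  have e1 : ∀ r : ℝ, T r * ((2 * Real.pi)⁻¹ * r * Real.tanh (Real.pi * r) : ℝ) =
      (2 * Real.pi : ℂ)⁻¹ * ((Real.pi : ℂ)⁻¹ * ∫ t in Set.Ioi (0 : ℝ),
        r * T r * (Real.sin (r * t) / Real.sinh (t / 2) : ℝ)) := by
    intro r
    rw [integral_const_mul]
    rw [integral_complex_ofReal, integral_Ioi_sin_div_sinh]
    push_cast
    field_simp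
  rw [setIntegral_congr_fun measurableSet_Ioi fun r _ => e1 r,
    integral_const_mul, integral_const_mul, integral_integral_swap hI]
  congr 1
  rw [← integral_const_mul]
  refine integral_congr_ae (Filter.Eventually.of_forall fun t => ?_)
  beta_reduce
  rw [neg_deriv_eq_integral hA hc heven, mul_div_assoc]
  congr 1
  rw [← integral_div]
  refine integral_congr_ae (Filter.Eventually.of_forall fun r => ?_)
  simp only [hT]
  push_cast
  ring

open scoped Convolution in
lemma contDiff_integral_of_compact {P G : Type*} [NormedAddCommGroup P] [NormedSpace ℝ P]
    [NormedAddCommGroup G] [NormedSpace ℝ G] [MeasurableSpace G] [BorelSpace G]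
    {μ : Measure G} [IsLocallyFiniteMeasure μ] {g : P → G → ℂ}
    (hg : ContDiff ℝ (⊤ : ℕ∞) fun q : P × G => g q.1 q.2) {k : Set G} (hk : IsCompact k)
    (hgs : ∀ p x, x ∉ k → g p x = 0) : ContDiff ℝ (⊤ : ℕ∞) fun p => ∫ x, g p x ∂μ := by
  have h := contDiffOn_convolution_right_with_param (μ := μ) (n := ⊤) (f := fun _ : G => (1 : ℂ))
    (ContinuousLinearMap.mul ℝ ℂ) (g := fun p x => g p (-x)) (s := Set.univ) (k := Neg.neg '' k)
    isOpen_univ (hk.image continuous_neg) (fun p x _ hx => hgs p (-x) fun h => hx ⟨-x, h, neg_neg x⟩)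
    (locallyIntegrable_const _) (ContDiff.contDiffOn (by
      exact hg.comp (contDiff_fst.prodMk contDiff_snd.neg)))
  rw [Set.univ_prod_univ, contDiffOn_univ] at h
  have h2 := h.comp (contDiff_id.prodMk (contDiff_const (c := (0 : G))) : ContDiff ℝ _ fun p : P => (p, (0 : G)))
  convert! h2 using 2 with p
  simp [convolution]

/-- The quotient `κ'(ρ) / ρ` of a radial profile, as a function on the plane. -/
def radialQuotient (κ : ℝ → ℂ) (p : ℂ) : ℂ := ((‖p‖⁻¹ : ℝ) : ℂ) * deriv κ ‖p‖

lemma norm_ofReal_add_mul_I (v s : ℝ) : ‖(v + s * I : ℂ)‖ = √(v ^ 2 + s ^ 2) := by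
  rw [Complex.norm_add_mul_I]

lemma deriv_zero_of_even {κ : ℝ → ℂ} (he : ∀ x, κ (-x) = κ x) : deriv κ 0 = 0 := by
  have h : deriv (fun x => κ (-x)) 0 = deriv κ 0 := by simp_rw [he]
  rw [deriv_comp_neg, neg_zero] at h
  exact self_eq_neg.mp h.symm

lemma exists_norm_radialQuotient_le {κ : ℝ → ℂ} (hκ : ContDiff ℝ (⊤ : ℕ∞) κ)
    (hc : HasCompactSupport κ) (he : ∀ x, κ (-x) = κ x) :
    ∃ C, 0 ≤ C ∧ ∀ p, ‖radialQuotient κ p‖ ≤ C := by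
  have h1 : ContDiff ℝ 1 (deriv κ) := by
    have : ContDiff ℝ ((1 : ℕ∞) + 1 : WithTop ℕ∞) κ := hκ.of_le (by norm_cast)
    exact (contDiff_succ_iff_deriv.mp this).2.2
  obtain ⟨C, hC⟩ := h1.lipschitzWith_of_hasCompactSupport hc.deriv one_ne_zero
  refine ⟨C, C.2, fun p => ?_⟩
  have := hC.dist_le_mul ‖p‖ 0
  rw [deriv_zero_of_even he, dist_zero_right, dist_zero_right, norm_norm] at this
  rw [radialQuotient, norm_mul, norm_real, norm_inv, norm_norm]
  rcases eq_or_ne p 0 with rfl | hp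
  · simp
  · rw [inv_mul_le_iff₀ (norm_pos_iff.mpr hp)]
    linarith

lemma measurable_radialQuotient {κ : ℝ → ℂ} (hκ : ContDiff ℝ (⊤ : ℕ∞) κ) :
    Measurable (radialQuotient κ) := by
  have : Continuous (deriv κ) := hκ.continuous_deriv (by norm_cast)
  unfold radialQuotient
  exact (measurable_ofReal.comp (measurable_norm.inv)).mul (this.measurable.comp measurable_norm)

lemma exists_radialQuotient_eq_zero {κ : ℝ → ℂ} (hc : HasCompactSupport κ) :
    ∃ M, ∀ p, M < ‖p‖ → radialQuotient κ p = 0 := by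
  obtain ⟨M, hM⟩ := hc.deriv.isCompact.isBounded.exists_norm_le
  refine ⟨M, fun p hp => ?_⟩
  have : deriv κ ‖p‖ = 0 := by
    by_contra h
    have := hM _ (subset_tsupport _ h)
    rw [norm_norm] at this
    linarith
  simp [radialQuotient, this]

lemma integrable_of_bounded_of_eq_zero {E : Type*} [NormedAddCommGroup E] [MeasurableSpace E]
    [BorelSpace E] [ProperSpace E] {μ : Measure E} [IsFiniteMeasureOnCompacts μ] {f : E → ℂ}
    (hf : AEStronglyMeasurable f μ) {C M : ℝ} (hC : ∀ p, ‖f p‖ ≤ C) (hM : ∀ p, M < ‖p‖ → f p = 0) :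
    Integrable f μ := by
  have hs : Function.support f ⊆ Metric.closedBall 0 M := fun x hx => by
    by_contra h
    exact hx (hM x (by simpa using h))
  rw [← integrableOn_iff_integrable_of_support_subset hs]
  exact Measure.integrableOn_of_bounded (isCompact_closedBall _ _).measure_lt_top.ne hf
    (Filter.Eventually.of_forall hC)

lemma integral_radialQuotient {κ : ℝ → ℂ} (hκ : ContDiff ℝ (⊤ : ℕ∞) κ)
    (hc : HasCompactSupport κ) : ∫ p, radialQuotient κ p = -(2 * Real.pi * κ 0) := by
  rw [← Complex.integral_comp_polarCoord_symm]
  have h1 : ∀ q ∈ polarCoord.target, q.1 • radialQuotient κ (Complex.polarCoord.symm q)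
      = deriv κ q.1 * 1 := by
    rintro ⟨x, θ⟩ hx
    have hx : 0 < x := hx.1
    have : ‖Complex.polarCoord.symm (x, θ)‖ = x := by
      rw [Complex.norm_polarCoord_symm, abs_of_pos hx]
    rw [radialQuotient, this, real_smul, ← mul_assoc, ← ofReal_mul, mul_inv_cancel₀ hx.ne']
    simp
  rw [setIntegral_congr_fun (by exact polarCoord.open_target.measurableSet) h1]
  rw [polarCoord_target, Measure.volume_eq_prod, setIntegral_prod_mul (f := fun x => deriv κ x)
    (g := fun _ => (1 : ℂ)), hc.integral_Ioi_deriv_eq (hκ.of_le (by norm_cast))]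
  simp [Real.pi_pos.le]
  ring_nf

lemma hasDerivAt_radial {κ : ℝ → ℂ} (hκ : ContDiff ℝ (⊤ : ℕ∞) κ) (v : ℝ) {s : ℝ} (hs : s ≠ 0) :
    HasDerivAt (fun v : ℝ => κ ‖(v + s * I : ℂ)‖) (v * radialQuotient κ (v + s * I)) v := by
  have h1 : HasDerivAt (fun v : ℝ => √(v ^ 2 + s ^ 2)) (2 * v / (2 * √(v ^ 2 + s ^ 2))) v := by
    have h2 : HasDerivAt (fun v : ℝ => v ^ 2 + s ^ 2) (2 * v) v := by
      simpa using (hasDerivAt_pow 2 v).add_const (s ^ 2)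
    exact h2.sqrt (by positivity)
  simp_rw [radialQuotient, norm_ofReal_add_mul_I]
  have h3 : HasDerivAt κ (deriv κ √(v ^ 2 + s ^ 2)) √(v ^ 2 + s ^ 2) :=
    (hκ.differentiable (by simp) _).hasDerivAt
  convert! h3.scomp v h1 using 1
  rw [real_smul, ← mul_assoc, ← ofReal_mul]
  congr 2
  field_simp

lemma hasDerivAt_integral_radial {κ : ℝ → ℂ} (hκ : ContDiff ℝ (⊤ : ℕ∞) κ)
    (hc : HasCompactSupport κ) (he : ∀ x, κ (-x) = κ x) (v : ℝ) :
    HasDerivAt (fun v : ℝ => ∫ s : ℝ, κ ‖(v + s * I : ℂ)‖)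
      (v * ∫ s : ℝ, radialQuotient κ (v + s * I)) v := by
  obtain ⟨C, hC0, hC⟩ := exists_norm_radialQuotient_le hκ hc he
  obtain ⟨M, hM⟩ := exists_radialQuotient_eq_zero hc
  obtain ⟨M', hM'⟩ := hc.isCompact.isBounded.exists_norm_le
  have habs : ∀ v s : ℝ, |s| ≤ ‖(v + s * I : ℂ)‖ := fun v s => by
    simpa using Complex.abs_im_le_norm (v + s * I : ℂ)
  have hcont : ∀ v : ℝ, Continuous fun s : ℝ => κ ‖(v + s * I : ℂ)‖ := fun v =>
    hκ.continuous.comp (by fun_prop)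
  rw [← integral_const_mul]
  refine (hasDerivAt_integral_of_dominated_loc_of_deriv_le (𝕜 := ℝ) (s := Metric.ball v 1)
    (bound := Set.indicator (Set.Icc (-M) M) fun _ => (|v| + 1) * C)
    (F' := fun v s => v * radialQuotient κ (v + s * I))
    (Metric.ball_mem_nhds v one_pos) (Filter.Eventually.of_forall fun v =>
      (hcont v).aestronglyMeasurable) ?_ ?_ ?_ ?_ ?_).2
  · refine (hcont v).integrable_of_hasCompactSupport
      (HasCompactSupport.of_support_subset_isCompact (isCompact_Icc (a := -M') (b := M')) ?_)
    intro s hs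
    have := hM' _ (subset_tsupport _ hs)
    rw [norm_norm] at this
    exact abs_le.mp ((habs v s).trans this)
  · exact (((measurable_radialQuotient hκ).comp (by fun_prop)).const_mul _).aestronglyMeasurable
  · refine Filter.Eventually.of_forall fun s x hx => ?_
    by_cases hs : s ∈ Set.Icc (-M) M
    · rw [Set.indicator_of_mem hs, norm_mul, norm_real]
      gcongr
      · have : |x - v| < 1 := hx
        have := abs_sub_abs_le_abs_sub x v
        rw [Real.norm_eq_abs]
        linarith
      · exact hC _
    · rw [Set.indicator_of_notMem hs, hM _ (lt_of_lt_of_le (not_le.mp fun h => hs (abs_le.mp h)) (habs x s))]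
      simp
  · rw [integrable_indicator_iff measurableSet_Icc]
    exact integrableOn_const (by simp)
  · have h0 : ∀ᵐ s : ℝ, s ≠ 0 := by
      simp [ae_iff]
    filter_upwards [h0] with s hs x hx
    exact hasDerivAt_radial hκ x hs

lemma integral_eq_two_mul_Ioi_of_even {f : ℝ → ℂ} (hf : Integrable f) (he : ∀ x, f (-x) = f x) :
    ∫ x, f x = 2 * ∫ x in Set.Ioi 0, f x := by
  rw [← intervalIntegral.integral_Iic_add_Ioi (b := 0) hf.integrableOn hf.integrableOn,
    ← neg_zero, ← integral_comp_neg_Ioi, neg_zero]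
  simp_rw [he]
  ring

lemma integrable_integral_add_mul_I {h : ℂ → ℂ} (hh : Integrable h) :
    Integrable fun v : ℝ => ∫ s : ℝ, h (v + s * I) := by
  have h1 := Complex.volume_preserving_equiv_real_prod.symm
  have h2 := (h1.integrable_comp_emb (MeasurableEquiv.measurableEmbedding _)).mpr hh
  rw [Measure.volume_eq_prod] at h2
  refine h2.integral_prod_left.congr (Filter.Eventually.of_forall fun v => ?_)
  exact integral_congr_ae (Filter.Eventually.of_forall fun s =>
    congrArg h (Complex.mk_eq_add_mul_I v s))

lemma integral_integral_add_mul_I {h : ℂ → ℂ} (hh : Integrable h) :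
    ∫ v : ℝ, ∫ s : ℝ, h (v + s * I) = ∫ p, h p := by
  have h1 := Complex.volume_preserving_equiv_real_prod.symm
  rw [← h1.integral_comp (MeasurableEquiv.measurableEmbedding _), Measure.volume_eq_prod,
    integral_prod]
  · refine integral_congr_ae (Filter.Eventually.of_forall fun v => integral_congr_ae
      (Filter.Eventually.of_forall fun s => ?_))
    exact congrArg h (Complex.mk_eq_add_mul_I v s).symm
  · exact (h1.integrable_comp_emb (MeasurableEquiv.measurableEmbedding _)).mpr hh

lemma image_two_sinh_Ioi : (fun t : ℝ => 2 * Real.sinh (t / 2)) '' Set.Ioi 0 = Set.Ioi 0 := by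
  ext u
  constructor
  · rintro ⟨t, ht, rfl⟩
    have : 0 < Real.sinh (t / 2) := Real.sinh_pos_iff.mpr (half_pos ht)
    exact mul_pos two_pos this
  · intro hu
    refine ⟨2 * Real.arsinh (u / 2), ?_, ?_⟩
    · exact mul_pos two_pos (Real.arsinh_pos_iff.mpr (half_pos hu))
    · simp only
      rw [mul_div_cancel_left₀ _ two_ne_zero, Real.sinh_arsinh]
      ring

lemma hasDerivAt_two_sinh (t : ℝ) :
    HasDerivAt (fun t : ℝ => 2 * Real.sinh (t / 2)) (Real.cosh (t / 2)) t := by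
  have := ((Real.hasDerivAt_sinh (t / 2)).comp t ((hasDerivAt_id t).div_const 2)).const_mul 2
  convert! this using 1
  ring

/-- Inversion at the origin of the Radon transform of a radial function, in the variable
`t` with `v = 2 sinh (t / 2)`. -/
lemma integral_neg_deriv_radon_div_sinh {K : ℂ → ℂ} (hK : ContDiff ℝ (⊤ : ℕ∞) K)
    (hc : HasCompactSupport K) (hrad : ∀ p, K p = K ‖p‖) :
    ∫ t in Set.Ioi (0 : ℝ),
      -deriv (fun t : ℝ => ∫ s : ℝ, K ((2 * Real.sinh (t / 2) : ℝ) + s * I)) t /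
        Real.sinh (t / 2) = 2 * Real.pi * K 0 := by
  have hκ : ContDiff ℝ (⊤ : ℕ∞) fun ρ : ℝ => K ρ := hK.comp ofRealCLM.contDiff
  have hκc : HasCompactSupport fun ρ : ℝ => K ρ :=
    hc.comp_isClosedEmbedding Complex.isometry_ofReal.isClosedEmbedding
  have he : ∀ x : ℝ, K ((-x : ℝ) : ℂ) = K x := fun x => by
    rw [hrad, hrad x]; simp
  obtain ⟨C, hC0, hC⟩ := exists_norm_radialQuotient_le hκ hκc he
  obtain ⟨M, hM⟩ := exists_radialQuotient_eq_zero hκc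
  set H := radialQuotient fun ρ : ℝ => K ρ with hH
  have hHi : Integrable H := integrable_of_bounded_of_eq_zero
    (measurable_radialQuotient hκ).aestronglyMeasurable hC hM
  set Q : ℝ → ℂ := fun v => ∫ s : ℝ, H (v + s * I) with hQ
  have hd : ∀ t : ℝ, HasDerivAt (fun t : ℝ => ∫ s : ℝ, K ((2 * Real.sinh (t / 2) : ℝ) + s * I))
      (Real.cosh (t / 2) • (((2 * Real.sinh (t / 2) : ℝ) : ℂ) * Q (2 * Real.sinh (t / 2)))) t := by
    intro t
    have h1 := hasDerivAt_integral_radial hκ hκc he (2 * Real.sinh (t / 2))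
    have h2 := h1.scomp t (hasDerivAt_two_sinh t)
    convert! h2 using 2 with t'
    exact integral_congr_ae (Filter.Eventually.of_forall fun s => hrad _)
  have h3 : ∀ t ∈ Set.Ioi (0 : ℝ),
      -deriv (fun t : ℝ => ∫ s : ℝ, K ((2 * Real.sinh (t / 2) : ℝ) + s * I)) t /
        Real.sinh (t / 2) = |Real.cosh (t / 2)| • ((-2) * Q (2 * Real.sinh (t / 2))) := by
    intro t ht
    have : (Real.sinh (t / 2) : ℂ) ≠ 0 :=
      ofReal_ne_zero.mpr (Real.sinh_pos_iff.mpr (half_pos ht)).ne'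
    rw [(hd t).deriv, abs_of_pos (Real.cosh_pos _), real_smul, real_smul, ofReal_mul]
    field_simp
    push_cast
    ring
  rw [setIntegral_congr_fun measurableSet_Ioi h3,
    ← integral_image_eq_integral_abs_deriv_smul measurableSet_Ioi
      (fun t _ => (hasDerivAt_two_sinh t).hasDerivWithinAt) (fun x _ y _ h => by
        have : Real.sinh (x / 2) = Real.sinh (y / 2) := by simpa using h
        have := Real.sinh_injective this
        linarith) (fun u => (-2) * Q u), image_two_sinh_Ioi]
  have h4 : ∫ v, Q v = 2 * ∫ v in Set.Ioi 0, Q v := by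
    refine integral_eq_two_mul_Ioi_of_even (integrable_integral_add_mul_I hHi) fun v => ?_
    simp only [hQ, hH, radialQuotient, norm_ofReal_add_mul_I, neg_sq]
  have h5 := integral_integral_add_mul_I hHi
  rw [integral_radialQuotient hκ hκc] at h5
  rw [integral_const_mul, neg_mul, ← h4, h5]
  simp

section Radon

variable {K : ℂ → ℂ}

lemma contDiff_radon (hK : ContDiff ℝ (⊤ : ℕ∞) K) (hc : HasCompactSupport K) :
    ContDiff ℝ (⊤ : ℕ∞) fun t : ℝ => ∫ s : ℝ, K ((2 * Real.sinh (t / 2) : ℝ) + s * I) := by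
  have h1 : ContDiff ℝ (⊤ : ℕ∞) fun v : ℝ => ∫ s : ℝ, K (v + s * I) := by
    obtain ⟨M, hM⟩ := hc.isCompact.isBounded.exists_norm_le
    refine contDiff_integral_of_compact (g := fun v s : ℝ => K (v + s * I))
      (k := Set.Icc (-M) M) ?_ isCompact_Icc fun v s hs => ?_
    · exact hK.comp ((ofRealCLM.contDiff.comp contDiff_fst).add
        ((ofRealCLM.contDiff.comp contDiff_snd).mul contDiff_const))
    · by_contra h
      have h1 : |s| ≤ ‖(v + s * I : ℂ)‖ := by simpa using Complex.abs_im_le_norm (v + s * I : ℂ)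
      exact hs (abs_le.mp (h1.trans (hM _ (subset_tsupport _ h))))
  have h2 : ContDiff ℝ (⊤ : ℕ∞) fun t : ℝ => 2 * Real.sinh (t / 2) :=
    contDiff_const.mul (Real.contDiff_sinh.comp (contDiff_id.div_const 2))
  exact h1.comp h2

lemma abs_le_abs_two_sinh (t : ℝ) : |t| ≤ |2 * Real.sinh (t / 2)| := by
  rw [abs_mul, abs_two, Real.abs_sinh, abs_div, abs_two]
  have := Real.self_le_sinh_iff.mpr (div_nonneg (abs_nonneg t) zero_le_two)
  linarith

lemma norm_le_norm_two_sinh_add_mul_I (q : ℝ × ℝ) :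
    ‖q‖ ≤ ‖((2 * Real.sinh (q.1 / 2) : ℝ) + q.2 * I : ℂ)‖ := by
  rw [Prod.norm_def, sup_le_iff, Real.norm_eq_abs, Real.norm_eq_abs]
  refine ⟨(abs_le_abs_two_sinh _).trans ?_, ?_⟩
  · simpa only [add_re, ofReal_re, re_ofReal_mul, I_re, mul_zero, add_zero] using
      Complex.abs_re_le_norm ((2 * Real.sinh (q.1 / 2) : ℝ) + q.2 * I : ℂ)
  · simpa only [add_im, ofReal_im, im_ofReal_mul, I_im, mul_one, zero_add] using
      Complex.abs_im_le_norm ((2 * Real.sinh (q.1 / 2) : ℝ) + q.2 * I : ℂ)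

lemma hasCompactSupport_comp_two_sinh (hc : HasCompactSupport K) :
    HasCompactSupport fun q : ℝ × ℝ => K ((2 * Real.sinh (q.1 / 2) : ℝ) + q.2 * I) := by
  obtain ⟨M, hM⟩ := hc.isCompact.isBounded.exists_norm_le
  refine HasCompactSupport.intro (isCompact_closedBall (0 : ℝ × ℝ) M) fun q hq => ?_
  by_contra h
  exact hq (by simpa only [mem_closedBall_zero_iff] using
    (norm_le_norm_two_sinh_add_mul_I q).trans (hM _ (subset_tsupport _ h)))

lemma hasCompactSupport_radon (hc : HasCompactSupport K) :
    HasCompactSupport fun t : ℝ => ∫ s : ℝ, K ((2 * Real.sinh (t / 2) : ℝ) + s * I) := by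
  refine HasCompactSupport.intro ((hasCompactSupport_comp_two_sinh hc).isCompact.image
    continuous_fst) fun t ht => ?_
  refine integral_eq_zero_of_ae (Filter.Eventually.of_forall fun s => ?_)
  by_contra h
  exact ht ⟨(t, s), subset_tsupport _ h, rfl⟩

/-- Inversion at the origin of the spherical transform of a radial function on the disc,
written in the coordinate `p` with `‖p‖ = 2 sinh (d / 2)`. -/
lemma integral_expTransform_radon (hK : ContDiff ℝ (⊤ : ℕ∞) K) (hc : HasCompactSupport K)
    (hrad : ∀ p, K p = K ‖p‖) :
    ∫ r in Set.Ioi (0 : ℝ), (∫ t : ℝ, cexp (I * r * t) *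
        ∫ s : ℝ, K ((2 * Real.sinh (t / 2) : ℝ) + s * I)) *
      ((2 * Real.pi)⁻¹ * r * Real.tanh (Real.pi * r) : ℝ) = K 0 := by
  rw [plancherel_density_integral (contDiff_radon hK hc) (hasCompactSupport_radon hc),
    integral_neg_deriv_radon_div_sinh hK hc hrad, ← mul_assoc, inv_mul_cancel₀, one_mul]
  · simp [Real.pi_ne_zero]
  · intro t
    refine integral_congr_ae (Filter.Eventually.of_forall fun s => ?_)
    simp only
    rw [hrad, hrad ((2 * Real.sinh (t / 2) : ℝ) + s * I), norm_ofReal_add_mul_I,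
      norm_ofReal_add_mul_I, neg_div, Real.sinh_neg, mul_neg, neg_sq]

lemma integrable_expTransform_radon_mul (hK : ContDiff ℝ (⊤ : ℕ∞) K) (hc : HasCompactSupport K) :
    IntegrableOn (fun r : ℝ => (∫ t : ℝ, cexp (I * r * t) *
        ∫ s : ℝ, K ((2 * Real.sinh (t / 2) : ℝ) + s * I)) *
      ((2 * Real.pi)⁻¹ * r * Real.tanh (Real.pi * r) : ℝ)) (Set.Ioi 0) := by
  have h1 := contDiff_radon hK hc
  have h2 := hasCompactSupport_radon hc
  refine Integrable.integrableOn (Integrable.mono (integrable_pow_mul_norm_expTransform h1 h2 1)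
    ?_ (Filter.Eventually.of_forall fun r => ?_))
  · refine Continuous.aestronglyMeasurable ((continuous_expTransform h1.continuous h2).mul
      (continuous_ofReal.comp ?_))
    simp_rw [Real.tanh_eq_sinh_div_cosh]
    exact (by fun_prop : Continuous fun r : ℝ => (2 * Real.pi)⁻¹ * r).mul
      (Continuous.div (by fun_prop) (by fun_prop) fun r => (Real.cosh_pos _).ne')
  · rw [norm_mul, norm_mul, norm_norm, mul_comm, norm_real, pow_one, Real.norm_eq_abs,
      Real.norm_eq_abs, abs_abs]
    refine mul_le_mul_of_nonneg_right ?_ (norm_nonneg _)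
    rw [abs_mul, abs_mul, abs_of_pos (by positivity : (0 : ℝ) < (2 * Real.pi)⁻¹), mul_comm,
      ← mul_assoc]
    have h3 : |Real.tanh (Real.pi * r)| ≤ 1 := (Real.abs_tanh_lt_one _).le
    have h4 : (2 * Real.pi)⁻¹ ≤ 1 := inv_le_one_of_one_le₀ (by linarith [Real.pi_gt_three])
    exact mul_le_of_le_one_left (abs_nonneg _)
      (mul_le_one₀ h3 (by positivity) h4)

end Radon

open scoped ComplexConjugate

/-- The involutive disc automorphism exchanging `0` and `z`. -/
def mobius (z u : ℂ) : ℂ := (z - u) / (1 - conj z * u)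

lemma mobius_zero_right (z : ℂ) : mobius z 0 = z := by simp [mobius]

lemma one_sub_conj_mul_ne_zero {z u : ℂ} (hz : ‖z‖ < 1) (hu : ‖u‖ ≤ 1) : 1 - conj z * u ≠ 0 := by
  intro h
  have h1 : ‖conj z * u‖ = 1 := by rw [← sub_eq_zero.mp h]; simp
  rw [norm_mul, RCLike.norm_conj] at h1
  nlinarith [norm_nonneg z, norm_nonneg u]

lemma norm_one_sub_conj_mul_sq_sub (z u : ℂ) :
    ‖1 - conj z * u‖ ^ 2 - ‖z - u‖ ^ 2 = (1 - ‖z‖ ^ 2) * (1 - ‖u‖ ^ 2) := by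
  simp only [← normSq_eq_norm_sq, normSq_apply, sub_re, sub_im, mul_re, mul_im, conj_re, conj_im,
    one_re, one_im]
  ring

lemma one_sub_norm_mobius_sq {z u : ℂ} (hz : ‖z‖ < 1) (hu : ‖u‖ ≤ 1) :
    1 - ‖mobius z u‖ ^ 2 = (1 - ‖z‖ ^ 2) * (1 - ‖u‖ ^ 2) / ‖1 - conj z * u‖ ^ 2 := by
  have h := norm_ne_zero_iff.mpr (one_sub_conj_mul_ne_zero hz hu)
  rw [← norm_one_sub_conj_mul_sq_sub, mobius, norm_div, div_pow, sub_div, div_self (pow_ne_zero 2 h)]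

lemma norm_mobius_lt_one {z u : ℂ} (hz : ‖z‖ < 1) (hu : ‖u‖ < 1) : ‖mobius z u‖ < 1 := by
  have h := norm_pos_iff.mpr (one_sub_conj_mul_ne_zero hz hu.le)
  have h1 := one_sub_norm_mobius_sq hz hu.le
  have h2 : 0 < (1 - ‖z‖ ^ 2) * (1 - ‖u‖ ^ 2) / ‖1 - conj z * u‖ ^ 2 := by
    have : 0 < 1 - ‖z‖ ^ 2 := by nlinarith [norm_nonneg z]
    have : 0 < 1 - ‖u‖ ^ 2 := by nlinarith [norm_nonneg u]
    positivity
  nlinarith [norm_nonneg (mobius z u)]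

lemma norm_mobius_eq_one {z b : ℂ} (hz : ‖z‖ < 1) (hb : ‖b‖ = 1) : ‖mobius z b‖ = 1 := by
  have h1 := one_sub_norm_mobius_sq hz hb.le
  rw [hb] at h1
  have : ‖mobius z b‖ ^ 2 = 1 := by linarith [show (1 - ‖z‖ ^ 2) * (1 - 1 ^ 2) / ‖1 - conj z * b‖ ^ 2 = 0 by simp]
  exact (pow_eq_one_iff_of_nonneg (norm_nonneg _) two_ne_zero).mp this

lemma mobius_mobius {z u : ℂ} (hz : ‖z‖ < 1) (hu : ‖u‖ ≤ 1) : mobius z (mobius z u) = u := by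
  have h := one_sub_conj_mul_ne_zero hz hu
  have h2 := one_sub_conj_mul_ne_zero hz hz.le
  have h3 : 1 - conj z * ((z - u) / (1 - conj z * u)) = (1 - conj z * z) / (1 - conj z * u) := by
    field_simp
    ring
  rw [mobius, mobius, h3, div_div_eq_mul_div, div_eq_iff h2, sub_mul, div_mul_cancel₀ _ h]
  ring

lemma norm_one_sub_conj_mul {z b : ℂ} (hb : ‖b‖ = 1) : ‖1 - conj z * b‖ = ‖z - b‖ := by
  have h := norm_one_sub_conj_mul_sq_sub z b
  rw [hb] at h
  have : ‖1 - conj z * b‖ ^ 2 = ‖z - b‖ ^ 2 := by linarith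
  exact (pow_left_inj₀ (norm_nonneg _) (norm_nonneg _) two_ne_zero).mp this

lemma Pk_mobius {z u b : ℂ} (hz : ‖z‖ < 1) (hu : ‖u‖ < 1) (hb : ‖b‖ = 1) :
    Pk (mobius z u) b = Pk z b * Pk u (mobius z b) := by
  have h1 := one_sub_conj_mul_ne_zero hz hu.le
  have h2 := one_sub_conj_mul_ne_zero hz hb.le
  have h3 : mobius z u - b = (z - u - b + conj z * u * b) / (1 - conj z * u) := by
    rw [mobius, eq_div_iff h1, sub_mul, div_mul_cancel₀ _ h1]
    ring
  have h4 : u - mobius z b = -(z - u - b + conj z * u * b) / (1 - conj z * b) := by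
    rw [mobius, eq_div_iff h2, sub_mul, div_mul_cancel₀ _ h2]
    ring
  have h5 := norm_ne_zero_iff.mpr h1
  have h6 : ‖z - b‖ ≠ 0 := by rw [← norm_one_sub_conj_mul hb]; exact norm_ne_zero_iff.mpr h2
  rw [Pk, Pk, Pk, one_sub_norm_mobius_sq hz hu.le, h3, h4, norm_div, norm_div, norm_neg,
    norm_one_sub_conj_mul hb, div_pow, div_pow]
  field_simp

lemma hasDerivAt_mobius {z u : ℂ} (hz : ‖z‖ < 1) (hu : ‖u‖ ≤ 1) :
    HasDerivAt (mobius z) (-(1 - conj z * z) / (1 - conj z * u) ^ 2) u := by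
  have h := one_sub_conj_mul_ne_zero hz hu
  have h1 : HasDerivAt (fun u => z - u) (-1) u := (hasDerivAt_id u).const_sub z
  have h2 : HasDerivAt (fun u => 1 - conj z * u) (-(conj z * 1)) u :=
    ((hasDerivAt_id u).const_mul (conj z)).const_sub 1
  convert! h1.div h2 h using 1
  ring

lemma abs_det_restrictScalars (c : ℂ) :
    |((ContinuousLinearMap.toSpanSingleton ℂ c).restrictScalars ℝ).det| = ‖c‖ ^ 2 := by
  have : ((ContinuousLinearMap.toSpanSingleton ℂ c).restrictScalars ℝ).det = normSq c := by
    rw [ContinuousLinearMap.det, ← Algebra.norm_complex_apply, Algebra.norm_apply]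
    congr 1
    ext x
    simp [mul_comm]
  rw [this, normSq_eq_norm_sq, abs_of_nonneg (by positivity)]

lemma integral_hypVol {E : Type*} [NormedAddCommGroup E] [NormedSpace ℝ E] (f : ℂ → E) :
    ∫ z, f z ∂hypVol = ∫ z in Metric.ball (0 : ℂ) 1, (4 / (1 - ‖z‖ ^ 2) ^ 2) • f z := by
  rw [hypVol, integral_withDensity_eq_integral_toReal_smul (by fun_prop)
    (Filter.Eventually.of_forall fun _ => ENNReal.ofReal_lt_top)]
  refine integral_congr_ae (Filter.Eventually.of_forall fun z => ?_)
  simp only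
  rw [ENNReal.toReal_ofReal (by positivity)]

lemma ae_hypVol : ∀ᵐ z ∂hypVol, ‖z‖ < 1 := by
  refine (withDensity_absolutelyContinuous _ _).ae_le ?_
  filter_upwards [ae_restrict_mem Metric.isOpen_ball.measurableSet] with z hz
  simpa using hz

/-- Change of variables for the hyperbolic area under an injective holomorphic map onto the disc. -/
lemma integral_hypVol_image {E : Type*} [NormedAddCommGroup E] [NormedSpace ℝ E] {s : Set ℂ}
    (hs : MeasurableSet s) {φ φ' : ℂ → ℂ} (hφ : ∀ u ∈ s, HasDerivAt φ (φ' u) u)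
    (hi : Set.InjOn φ s) (him : φ '' s = Metric.ball 0 1) (f : ℂ → E) :
    ∫ z, f z ∂hypVol = ∫ u in s, (‖φ' u‖ ^ 2 * (4 / (1 - ‖φ u‖ ^ 2) ^ 2)) • f (φ u) := by
  rw [integral_hypVol, ← him, integral_image_eq_integral_abs_det_fderiv_smul volume hs
    (fun u hu => ((hφ u hu).hasFDerivAt.restrictScalars ℝ).hasFDerivWithinAt) hi]
  simp_rw [abs_det_restrictScalars, smul_smul]

lemma integral_mobius {E : Type*} [NormedAddCommGroup E] [NormedSpace ℝ E] {z : ℂ} (hz : ‖z‖ < 1)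
    (f : ℂ → E) : ∫ u, f (mobius z u) ∂hypVol = ∫ u, f u ∂hypVol := by
  have hmem : ∀ u ∈ Metric.ball (0 : ℂ) 1, ‖u‖ < 1 := fun u hu => by simpa using hu
  rw [integral_hypVol_image Metric.isOpen_ball.measurableSet
    (fun u hu => hasDerivAt_mobius hz (hmem u hu).le) _ _ f, integral_hypVol]
  · refine setIntegral_congr_fun Metric.isOpen_ball.measurableSet fun u hu => ?_
    have hu := hmem u hu
    have h1 : ‖1 - conj z * z‖ = 1 - ‖z‖ ^ 2 := by
      rw [conj_mul', ← ofReal_pow, ← ofReal_one, ← ofReal_sub, norm_real, Real.norm_eq_abs, abs_of_pos]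
      nlinarith [norm_nonneg z]
    have h2 := norm_ne_zero_iff.mpr (one_sub_conj_mul_ne_zero hz hu.le)
    have h3 : 1 - ‖z‖ ^ 2 ≠ 0 := by nlinarith [norm_nonneg z]
    have h4 : 1 - ‖u‖ ^ 2 ≠ 0 := by nlinarith [norm_nonneg u]
    congr 1
    rw [one_sub_norm_mobius_sq hz hu.le, norm_div, norm_neg, h1, norm_pow]
    field_simp
  · intro u hu v hv h
    rw [← mobius_mobius hz (hmem u hu).le, h, mobius_mobius hz (hmem v hv).le]
  · ext u
    constructor
    · rintro ⟨v, hv, rfl⟩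
      simpa using norm_mobius_lt_one hz (hmem v hv)
    · intro hu
      exact ⟨mobius z u, by simpa using norm_mobius_lt_one hz (hmem u hu),
        mobius_mobius hz (hmem u hu).le⟩

lemma integral_circleMeasure {g : ℂ → ℂ} (hg : Measurable g) :
    ∫ b, g b ∂circleMeasure =
      (2 * Real.pi : ℂ)⁻¹ * ∫ θ in (0 : ℝ)..2 * Real.pi, g (cexp (θ * I)) := by
  rw [circleMeasure, integral_smul_measure, integral_map (by fun_prop) hg.aestronglyMeasurable,
    intervalIntegral.integral_of_le Real.two_pi_pos.le, ENNReal.toReal_inv,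
    ENNReal.toReal_ofReal Real.two_pi_pos.le, real_smul]
  push_cast
  rfl

lemma ae_circleMeasure : ∀ᵐ b ∂circleMeasure, ‖b‖ = 1 := by
  refine Measure.ae_smul_measure ?_ _
  rw [ae_map_iff (by fun_prop) (measurableSet_eq_fun measurable_norm measurable_const)]
  exact Filter.Eventually.of_forall fun θ => Complex.norm_exp_ofReal_mul_I θ

instance : IsProbabilityMeasure circleMeasure := by
  constructor
  rw [circleMeasure, Measure.smul_apply, Measure.map_apply (by fun_prop) MeasurableSet.univ]
  simp only [Set.preimage_univ, Measure.restrict_apply_univ, Real.volume_Ioc, sub_zero, smul_eq_mul]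
  exact ENNReal.inv_mul_cancel (by simp [Real.pi_pos]) ENNReal.ofReal_ne_top

lemma periodic_comp_exp_mul_I {E : Type*} (g : ℂ → E) :
    Function.Periodic (fun θ : ℝ => g (cexp (θ * I))) (2 * Real.pi) := fun θ => by
  simp only
  rw [ofReal_add, add_mul, Complex.exp_add]
  push_cast
  rw [Complex.exp_two_pi_mul_I, mul_one]

lemma integral_circleMeasure_mul {g : ℂ → ℂ} (hg : Measurable g) {c : ℂ} (hc : ‖c‖ = 1) :
    ∫ b, g (c * b) ∂circleMeasure = ∫ b, g b ∂circleMeasure := by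
  have hm : Measurable fun b => g (c * b) := hg.comp (measurable_const_mul c)
  rw [integral_circleMeasure hg, integral_circleMeasure hm]
  have hc' : c = cexp (c.arg * I) := by
    conv_lhs => rw [← norm_mul_exp_arg_mul_I c, hc, ofReal_one, one_mul]
  have h1 : ∀ θ : ℝ, g (c * cexp (θ * I)) = (fun θ : ℝ => g (cexp (θ * I))) (θ + c.arg) := by
    intro θ
    simp only
    rw [ofReal_add, add_mul, Complex.exp_add, ← hc', mul_comm]
  simp only [h1]
  rw [intervalIntegral.integral_comp_add_right (fun θ : ℝ => g (cexp (θ * I))), zero_add, add_comm (2 * Real.pi),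
    (periodic_comp_exp_mul_I g).intervalIntegral_add_eq c.arg 0, zero_add]

/-- A lift to `ℝ` of the boundary action of `mobius z`. -/
def mobiusLift (z : ℂ) (θ : ℝ) : ℝ := θ + Real.pi - 2 * (Complex.log (1 - conj z * cexp (θ * I))).im

lemma re_one_sub_conj_mul_pos {z u : ℂ} (hz : ‖z‖ < 1) (hu : ‖u‖ ≤ 1) :
    0 < (1 - conj z * u).re := by
  have h1 : ‖conj z * u‖ < 1 := by
    rw [norm_mul, RCLike.norm_conj]
    nlinarith [norm_nonneg z, norm_nonneg u]
  have := Complex.re_le_norm (conj z * u)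
  rw [sub_re, one_re]
  linarith

lemma exp_mobiusLift {z : ℂ} (hz : ‖z‖ < 1) (θ : ℝ) :
    cexp (mobiusLift z θ * I) = mobius z (cexp (θ * I)) := by
  have hb : ‖cexp (θ * I)‖ = 1 := Complex.norm_exp_ofReal_mul_I θ
  have hq := one_sub_conj_mul_ne_zero hz hb.le
  rw [mobiusLift]
  set b := cexp (θ * I) with hbdef
  set q := 1 - conj z * b with hqdef
  have h1 : cexp (-(2 * (Complex.log q).im * I)) = conj q / q := by
    have h2 : -(2 * (Complex.log q).im * I) = conj (Complex.log q) - Complex.log q := by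
      apply Complex.ext <;> simp
      ring
    rw [h2, Complex.exp_sub, Complex.exp_conj, Complex.exp_log hq]
  have h3 : ((θ + Real.pi - 2 * (Complex.log q).im : ℝ) : ℂ) * I
      = θ * I + Real.pi * I + -(2 * (Complex.log q).im * I) := by
    push_cast; ring
  have h4 : b * conj b = 1 := by rw [mul_conj', hb]; simp
  rw [h3, Complex.exp_add, Complex.exp_add, h1, Complex.exp_pi_mul_I, ← hbdef, mobius, ← hqdef,
    mul_div_assoc', div_left_inj' hq, hqdef, map_sub, map_mul, conj_conj, map_one]
  linear_combination z * h4

lemma hasDerivAt_mobiusLift {z : ℂ} (hz : ‖z‖ < 1) (θ : ℝ) :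
    HasDerivAt (mobiusLift z) (Pk z (cexp (θ * I))) θ := by
  have hb : ‖cexp (θ * I)‖ = 1 := Complex.norm_exp_ofReal_mul_I θ
  have hq := one_sub_conj_mul_ne_zero hz hb.le
  have h1 : HasDerivAt (fun θ : ℝ => cexp (θ * I)) (cexp (θ * I) * (1 * I)) θ :=
    (((hasDerivAt_id (θ : ℂ)).mul_const I).cexp).comp_ofReal
  have h2 := ((h1.const_mul (conj z)).const_sub 1).clog_real (Or.inl (re_one_sub_conj_mul_pos hz hb.le))
  have h3 := (Complex.imCLM.hasFDerivAt.comp_hasDerivAt θ h2).const_mul 2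
  convert! ((hasDerivAt_id θ).add_const Real.pi).sub h3 using 1
  set b := cexp (θ * I) with hbdef
  rw [Pk, ← norm_one_sub_conj_mul hb]
  have h4 : -(conj z * (b * (1 * I))) / (1 - conj z * b)
      = -(I * ((conj z * b) * conj (1 - conj z * b))) / ((‖1 - conj z * b‖ ^ 2 : ℝ) : ℂ) := by
    have h5 : conj (1 - conj z * b) ≠ 0 := (map_ne_zero _).mpr hq
    rw [ofReal_pow, ← mul_conj', div_eq_div_iff hq (mul_ne_zero hq h5)]
    ring
  have h6 : ‖1 - conj z * b‖ ^ 2 ≠ 0 := pow_ne_zero 2 (norm_ne_zero_iff.mpr hq)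
  have h7 : ‖1 - conj z * b‖ ^ 2 = 1 - 2 * (conj z * b).re + ‖z‖ ^ 2 := by
    have h8 : ‖conj z * b‖ ^ 2 = ‖z‖ ^ 2 := by simp [hb]
    rw [← h8, ← normSq_eq_norm_sq, ← normSq_eq_norm_sq, normSq_apply, normSq_apply]
    simp only [sub_re, sub_im, one_re, one_im]
    ring
  have h8 : ((conj z * b) * conj (1 - conj z * b)).re = (conj z * b).re - ‖z‖ ^ 2 := by
    have h8 : ‖conj z * b‖ ^ 2 = ‖z‖ ^ 2 := by simp [hb]
    rw [← h8, ← normSq_eq_norm_sq, normSq_apply]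
    simp only [sub_re, sub_im, one_re, one_im, map_sub, map_one, mul_re _ ((1 : ℂ) - _), conj_re, conj_im]
    ring
  rw [h4, imCLM_apply, div_ofReal_im, neg_im, I_mul_im, h8, eq_sub_iff_add_eq, div_add' _ _ _ h6,
    div_eq_one_iff_eq h6]
  field_simp
  rw [h7]
  ring

lemma continuous_Pk_exp {z : ℂ} (hz : ‖z‖ < 1) : Continuous fun θ : ℝ => Pk z (cexp (θ * I)) := by
  unfold Pk
  refine Continuous.div (by fun_prop) (by fun_prop) fun θ => ?_
  rw [← norm_one_sub_conj_mul (Complex.norm_exp_ofReal_mul_I θ)]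
  exact pow_ne_zero 2 (norm_ne_zero_iff.mpr
    (one_sub_conj_mul_ne_zero hz (Complex.norm_exp_ofReal_mul_I θ).le))

@[fun_prop]
lemma measurable_Pk : Measurable fun q : ℂ × ℂ => Pk q.1 q.2 := by
  unfold Pk
  fun_prop

/-- The Poisson kernel is the boundary Jacobian of `mobius z`. -/
lemma integral_Pk_mul_comp_mobius {z : ℂ} (hz : ‖z‖ < 1) {g : ℂ → ℂ} (hg : Measurable g)
    (hgc : Continuous fun θ : ℝ => g (cexp (θ * I))) :
    ∫ b, Pk z b * g (mobius z b) ∂circleMeasure = ∫ b, g b ∂circleMeasure := by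
  have hm : Measurable fun b => (Pk z b : ℂ) * g (mobius z b) := by
    refine (measurable_ofReal.comp (measurable_Pk.comp measurable_prodMk_left)).mul (hg.comp ?_)
    unfold mobius
    fun_prop
  rw [integral_circleMeasure hg, integral_circleMeasure hm]
  congr 1
  simp_rw [← exp_mobiusLift hz]
  have h := intervalIntegral.integral_deriv_smul_comp (a := 0) (b := 2 * Real.pi)
    (g := fun θ : ℝ => g (cexp (θ * I))) (fun θ _ => hasDerivAt_mobiusLift hz θ)
    (continuous_Pk_exp hz).continuousOn hgc
  simp only [Function.comp_def, real_smul] at h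
  have h1 : mobiusLift z (2 * Real.pi) = mobiusLift z 0 + 2 * Real.pi := by
    simp [mobiusLift]; ring
  rw [h, h1, (periodic_comp_exp_mul_I g).intervalIntegral_add_eq _ 0, zero_add]

/-- The Cayley transform from the right half-plane to the disc, sending `∞` to `b`. -/
def cayley (b w : ℂ) : ℂ := b * ((w - 1) / (w + 1))

/-- Horocyclic coordinates on the disc based at the boundary point `b`. -/
def horo (b : ℂ) (t s : ℝ) : ℂ := cayley b (Real.exp t + (Real.exp (t / 2) * s : ℝ) * I)

lemma add_one_ne_zero_of_re_pos {w : ℂ} (hw : 0 < w.re) : w + 1 ≠ 0 := fun h => by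
  have := congrArg re h
  simp at this
  linarith

lemma one_sub_norm_cayley_sq {b w : ℂ} (hb : ‖b‖ = 1) (hw : 0 < w.re) :
    1 - ‖cayley b w‖ ^ 2 = 4 * w.re / ‖w + 1‖ ^ 2 := by
  have h := pow_ne_zero 2 (norm_ne_zero_iff.mpr (add_one_ne_zero_of_re_pos hw))
  rw [cayley, norm_mul, hb, one_mul, norm_div, div_pow, one_sub_div h]
  congr 1
  rw [← normSq_eq_norm_sq, ← normSq_eq_norm_sq, normSq_apply, normSq_apply]
  simp
  ring

lemma norm_cayley_lt_one {b w : ℂ} (hb : ‖b‖ = 1) (hw : 0 < w.re) : ‖cayley b w‖ < 1 := by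
  have h1 := one_sub_norm_cayley_sq hb hw
  have h2 := norm_pos_iff.mpr (add_one_ne_zero_of_re_pos hw)
  have h3 : 0 < 4 * w.re / ‖w + 1‖ ^ 2 := by positivity
  nlinarith [norm_nonneg (cayley b w)]

lemma Pk_cayley {b w : ℂ} (hb : ‖b‖ = 1) (hw : 0 < w.re) : Pk (cayley b w) b = w.re := by
  have h := add_one_ne_zero_of_re_pos hw
  have h1 : cayley b w - b = b * (-2 / (w + 1)) := by
    rw [cayley]
    field_simp
    ring
  have h2 := pow_ne_zero 2 (norm_ne_zero_iff.mpr h)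
  rw [Pk, one_sub_norm_cayley_sq hb hw, h1, norm_mul, hb, one_mul, norm_div, norm_neg, div_pow,
    Complex.norm_ofNat]
  field_simp
  ring

lemma hasDerivAt_cayley (b : ℂ) {w : ℂ} (hw : 0 < w.re) :
    HasDerivAt (cayley b) (b * (2 / (w + 1) ^ 2)) w := by
  have h := ((hasDerivAt_id w).sub_const 1).div ((hasDerivAt_id w).add_const 1)
    (add_one_ne_zero_of_re_pos hw)
  convert! h.const_mul b using 2
  simp only [id]
  ring

lemma cayley_injOn {b : ℂ} (hb : ‖b‖ = 1) : Set.InjOn (cayley b) {w | 0 < w.re} := by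
  intro w hw v hv h
  have hb0 : b ≠ 0 := norm_ne_zero_iff.mp (by rw [hb]; exact one_ne_zero)
  have h1 := add_one_ne_zero_of_re_pos hw
  have h2 := add_one_ne_zero_of_re_pos hv
  have h3 := mul_left_cancel₀ hb0 h
  rw [div_eq_div_iff h1 h2] at h3
  linear_combination h3 / 2

lemma image_cayley {b : ℂ} (hb : ‖b‖ = 1) : cayley b '' {w | 0 < w.re} = Metric.ball 0 1 := by
  ext u
  constructor
  · rintro ⟨w, hw, rfl⟩
    simpa using norm_cayley_lt_one hb hw
  · intro hu
    have hu : ‖u‖ < 1 := by simpa using hu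
    have hb0 : b ≠ 0 := norm_ne_zero_iff.mp (by rw [hb]; exact one_ne_zero)
    have h0 : b - u ≠ 0 := fun h => by
      rw [← sub_eq_zero.mp h, hb] at hu
      exact lt_irrefl _ hu
    refine ⟨(b + u) / (b - u), ?_, ?_⟩
    · have h1 : ((b + u) / (b - u)).re = (‖b‖ ^ 2 - ‖u‖ ^ 2) / ‖b - u‖ ^ 2 := by
        rw [div_re, ← normSq_eq_norm_sq, ← normSq_eq_norm_sq, ← normSq_eq_norm_sq, ← add_div]
        congr 1
        simp only [normSq_apply, add_re, sub_re, add_im, sub_im]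
        ring
      have h2 := norm_pos_iff.mpr h0
      have h3 : 0 < ‖b‖ ^ 2 - ‖u‖ ^ 2 := by rw [hb]; nlinarith [norm_nonneg u]
      rw [Set.mem_ofPred_eq, h1]
      positivity
    · have h1 : (b + u) / (b - u) - 1 = 2 * u / (b - u) := by
        rw [div_sub_one h0]; ring
      have h2 : (b + u) / (b - u) + 1 = 2 * b / (b - u) := by
        rw [div_add_one h0]; ring
      rw [cayley, h1, h2]
      field_simp

lemma cayley_density {b w : ℂ} (hb : ‖b‖ = 1) (hw : 0 < w.re) :
    ‖b * (2 / (w + 1) ^ 2)‖ ^ 2 * (4 / (1 - ‖cayley b w‖ ^ 2) ^ 2) = (w.re ^ 2)⁻¹ := by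
  have h2 := norm_ne_zero_iff.mpr (add_one_ne_zero_of_re_pos hw)
  rw [one_sub_norm_cayley_sq hb hw, norm_mul, hb, norm_div, norm_pow, Complex.norm_ofNat]
  field_simp
  norm_num

lemma horo_re (t s : ℝ) :
    (Real.exp t + (Real.exp (t / 2) * s : ℝ) * I : ℂ).re = Real.exp t := by
  rw [add_re, ofReal_re, re_ofReal_mul, I_re, mul_zero, add_zero]

lemma horo_re_pos (t s : ℝ) : 0 < (Real.exp t + (Real.exp (t / 2) * s : ℝ) * I : ℂ).re := by
  rw [horo_re]
  exact Real.exp_pos t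

lemma Pk_horo {b : ℂ} (hb : ‖b‖ = 1) (t s : ℝ) : Pk (horo b t s) b = Real.exp t := by
  rw [horo, Pk_cayley hb (horo_re_pos t s), horo_re]

lemma measurableSet_re_pos : MeasurableSet {w : ℂ | 0 < w.re} :=
  measurableSet_lt measurable_const Complex.measurable_re

lemma integrableOn_cayley {b : ℂ} (hb : ‖b‖ = 1) {g : ℂ → ℂ} (hg : Integrable g hypVol) :
    IntegrableOn (fun w => (w.re ^ 2)⁻¹ • g (cayley b w)) {w : ℂ | 0 < w.re} := by
  rw [hypVol, integrable_withDensity_iff_integrable_smul' (by fun_prop)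
    (Filter.Eventually.of_forall fun _ => ENNReal.ofReal_lt_top)] at hg
  change IntegrableOn _ _ volume at hg
  rw [← image_cayley hb, integrableOn_image_iff_integrableOn_abs_det_fderiv_smul volume
    measurableSet_re_pos (fun u hu =>
      ((hasDerivAt_cayley b hu).hasFDerivAt.restrictScalars ℝ).hasFDerivWithinAt)
    (cayley_injOn hb)] at hg
  refine hg.congr_fun (fun w hw => ?_) measurableSet_re_pos
  simp only [abs_det_restrictScalars]
  rw [ENNReal.toReal_ofReal (by positivity), smul_smul, cayley_density hb hw]

/-- Integration over the disc in horocyclic coordinates. -/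
lemma integral_horo {b : ℂ} (hb : ‖b‖ = 1) {g : ℂ → ℂ} (hg : Integrable g hypVol) :
    ∫ u, g u ∂hypVol = ∫ t : ℝ, Real.exp (-t / 2) • ∫ s : ℝ, g (horo b t s) := by
  have hI := integrableOn_cayley hb hg
  rw [← integrable_indicator_iff measurableSet_re_pos] at hI
  rw [integral_hypVol_image measurableSet_re_pos (fun w hw => hasDerivAt_cayley b hw)
    (cayley_injOn hb) (image_cayley hb),
    setIntegral_congr_fun (g := fun w => (w.re ^ 2)⁻¹ • g (cayley b w)) measurableSet_re_pos
      (fun w hw => by rw [cayley_density hb hw]), ← integral_indicator measurableSet_re_pos,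
    ← integral_integral_add_mul_I hI]
  have h1 : (fun v : ℝ => ∫ s : ℝ, Set.indicator {w : ℂ | 0 < w.re}
      (fun w => (w.re ^ 2)⁻¹ • g (cayley b w)) (v + s * I)) =
      Set.indicator (Set.Ioi 0) fun v : ℝ => (v ^ 2)⁻¹ • ∫ s : ℝ, g (cayley b (v + s * I)) := by
    ext v
    by_cases hv : 0 < v
    · rw [Set.indicator_of_mem (Set.mem_Ioi.mpr hv), ← integral_smul]
      refine integral_congr_ae (Filter.Eventually.of_forall fun s => ?_)
      simp [hv]
    · rw [Set.indicator_of_notMem (by simpa using hv)]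
      refine integral_eq_zero_of_ae (Filter.Eventually.of_forall fun s => ?_)
      simp [hv]
  rw [h1, integral_indicator measurableSet_Ioi, ← Real.range_exp, ← Set.image_univ,
    integral_image_eq_integral_abs_deriv_smul MeasurableSet.univ
      (fun t _ => (Real.hasDerivAt_exp t).hasDerivWithinAt) Real.exp_injective.injOn,
    setIntegral_univ]
  refine integral_congr_ae (Filter.Eventually.of_forall fun t => ?_)
  simp only
  have h2 := Measure.integral_comp_mul_left (fun s : ℝ => g (cayley b (Real.exp t + s * I)))
    (Real.exp (t / 2))
  simp only [horo]
  rw [h2, smul_smul, smul_smul, abs_of_pos (Real.exp_pos t),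
    abs_of_pos (inv_pos.mpr (Real.exp_pos _)), ← Real.exp_nat_mul, ← Real.exp_neg, ← Real.exp_neg,
    ← Real.exp_add, ← Real.exp_add]
  congr 2
  push_cast
  ring

/-- The parametrisation of the disc by the plane in which `‖p‖ = 2 sinh (d / 2)`, with `d` the
hyperbolic distance to the origin. -/
def toDisc (p : ℂ) : ℂ := ((√(4 + ‖p‖ ^ 2))⁻¹ : ℝ) * p

lemma one_sub_norm_toDisc_sq (p : ℂ) : 1 - ‖toDisc p‖ ^ 2 = 4 / (4 + ‖p‖ ^ 2) := by
  have h : (0 : ℝ) < 4 + ‖p‖ ^ 2 := by positivity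
  rw [toDisc, norm_mul, norm_real, norm_inv, Real.norm_eq_abs, abs_of_nonneg (Real.sqrt_nonneg _),
    mul_pow, inv_pow, Real.sq_sqrt h.le]
  field_simp
  ring

lemma norm_toDisc_lt_one (p : ℂ) : ‖toDisc p‖ < 1 := by
  have h1 := one_sub_norm_toDisc_sq p
  have h3 : 0 < 4 / (4 + ‖p‖ ^ 2) := by positivity
  nlinarith [norm_nonneg (toDisc p)]

lemma toDisc_zero : toDisc 0 = 0 := by simp [toDisc]

lemma mul_toDisc {c : ℂ} (hc : ‖c‖ = 1) (p : ℂ) : c * toDisc p = toDisc (c * p) := by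
  rw [toDisc, toDisc, norm_mul, hc, one_mul]
  ring

lemma contDiff_toDisc : ContDiff ℝ (⊤ : ℕ∞) toDisc := by
  unfold toDisc
  refine ContDiff.mul (ofRealCLM.contDiff.comp (ContDiff.inv (ContDiff.sqrt
    (contDiff_const.add (contDiff_norm_sq ℝ)) fun p => ?_) fun p => ?_)) contDiff_id <;> positivity

lemma norm_horo {b : ℂ} (hb : ‖b‖ = 1) (t s : ℝ) :
    ‖horo b t s‖ = ‖toDisc ((2 * Real.sinh (t / 2) : ℝ) + s * I)‖ := by
  have h1 := one_sub_norm_cayley_sq hb (horo_re_pos t s)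
  rw [← horo] at h1
  have h2 := one_sub_norm_toDisc_sq ((2 * Real.sinh (t / 2) : ℝ) + s * I)
  have h3 : ‖(Real.exp t + (Real.exp (t / 2) * s : ℝ) * I + 1 : ℂ)‖ ^ 2 =
      Real.exp t * (4 + ‖((2 * Real.sinh (t / 2) : ℝ) + s * I : ℂ)‖ ^ 2) := by
    have h4 : Real.exp t = Real.exp (t / 2) ^ 2 := by
      rw [← Real.exp_nat_mul]; push_cast; ring_nf
    have h5 : Real.sinh (t / 2) = (Real.exp (t / 2) - (Real.exp (t / 2))⁻¹) / 2 := by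
      rw [Real.sinh_eq, Real.exp_neg]
    have h6 := (Real.exp_pos (t / 2)).ne'
    rw [← normSq_eq_norm_sq, ← normSq_eq_norm_sq, normSq_apply, normSq_apply, h4, h5]
    simp only [add_re, add_im, ofReal_re, ofReal_im, re_ofReal_mul, im_ofReal_mul, I_re, I_im,
      one_re, one_im]
    field_simp
    ring
  have h4 : ‖horo b t s‖ ^ 2 = ‖toDisc ((2 * Real.sinh (t / 2) : ℝ) + s * I)‖ ^ 2 := by
    have h5 : 4 * (Real.exp t + (Real.exp (t / 2) * s : ℝ) * I : ℂ).re /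
        ‖(Real.exp t + (Real.exp (t / 2) * s : ℝ) * I + 1 : ℂ)‖ ^ 2 =
        4 / (4 + ‖((2 * Real.sinh (t / 2) : ℝ) + s * I : ℂ)‖ ^ 2) := by
      have h6 := (Real.exp_pos t).ne'
      rw [h3]
      simp only [add_re, ofReal_re, re_ofReal_mul, I_re, mul_zero, add_zero]
      field_simp
    linarith
  exact (pow_left_inj₀ (norm_nonneg _) (norm_nonneg _) two_ne_zero).mp h4

instance : SFinite hypVol := by
  unfold hypVol
  infer_instance

lemma integrable_of_ae_bounded {α E : Type*} [MeasurableSpace α] [NormedAddCommGroup E]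
    {μ : Measure α} {F : α → E}
    (hF : AEStronglyMeasurable F μ) {S : Set α} (hS : MeasurableSet S) (hμ : μ S ≠ ⊤)
    (h0 : ∀ᵐ q ∂μ, q ∉ S → F q = 0) {C : ℝ} (hC : ∀ᵐ q ∂μ, ‖F q‖ ≤ C) : Integrable F μ := by
  have h1 : IntegrableOn F S μ := Measure.integrableOn_of_bounded hμ hF (ae_restrict_of_ae hC)
  rw [← integrable_indicator_iff hS] at h1
  refine h1.congr ?_
  filter_upwards [h0] with q hq
  by_cases h : q ∈ S
  · exact Set.indicator_of_mem h _
  · rw [Set.indicator_of_notMem h, hq h]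

lemma measurableSet_one_sub_norm_sq (δ : ℝ) : MeasurableSet {z : ℂ | δ ≤ 1 - ‖z‖ ^ 2} :=
  measurableSet_le measurable_const (by fun_prop)

lemma hypVol_one_sub_norm_sq_ne_top {δ : ℝ} (hδ : 0 < δ) :
    hypVol {z : ℂ | δ ≤ 1 - ‖z‖ ^ 2} ≠ ⊤ := by
  rw [hypVol, withDensity_apply _ (measurableSet_one_sub_norm_sq δ)]
  refine ((setLIntegral_mono (measurable_const (a := ENNReal.ofReal (4 / δ ^ 2)))
    fun z hz => ?_).trans_lt ?_).ne
  · have hz : δ ≤ 1 - ‖z‖ ^ 2 := hz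
    gcongr
  · rw [setLIntegral_const]
    refine ENNReal.mul_lt_top ENNReal.ofReal_lt_top ?_
    rw [Measure.restrict_apply (measurableSet_one_sub_norm_sq δ)]
    exact (measure_mono Set.inter_subset_right).trans_lt measure_ball_lt_top

/-- The hyperbolic autocorrelation of `f`. -/
def autocorr (f : ℂ → ℂ) (u : ℂ) : ℂ := ∫ z, conj (f z) * f (mobius z u) ∂hypVol

@[fun_prop]
lemma measurable_mobius : Measurable fun q : ℂ × ℂ => mobius q.1 q.2 := by
  unfold mobius
  fun_prop

section Autocorr

variable {f : ℂ → ℂ}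

lemma measurable_autocorr (hf : Measurable f) : Measurable (autocorr f) := by
  have h : Measurable fun q : ℂ × ℂ => conj (f q.2) * f (mobius q.2 q.1) := by
    refine Measurable.mul ?_ (hf.comp (measurable_mobius.comp measurable_swap))
    exact Complex.continuous_conj.measurable.comp (hf.comp measurable_snd)
  exact h.stronglyMeasurable.integral_prod_right.measurable

lemma autocorr_zero : autocorr f 0 = ((∫ z, ‖f z‖ ^ 2 ∂hypVol : ℝ) : ℂ) := by
  simp_rw [autocorr, mobius_zero_right, conj_mul']
  rw [← integral_complex_ofReal]
  push_cast
  rfl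

lemma exists_le_one_sub_norm_sq (hs : tsupport f ⊆ Metric.ball 0 1) :
    ∃ δ, 0 < δ ∧ (∀ z, f z ≠ 0 → δ ≤ 1 - ‖z‖ ^ 2) ∧
      ∀ z u, ‖u‖ < 1 → f z ≠ 0 → f (mobius z u) ≠ 0 → δ ≤ 1 - ‖u‖ ^ 2 := by
  obtain ⟨ρ', hρ', h'⟩ := exists_lt_subset_ball (isClosed_tsupport f) hs
  set ρ := max ρ' 0 with hρdef
  have hρ : ρ < 1 := max_lt hρ' one_pos
  have hρ0 : 0 ≤ ρ := le_max_right _ _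
  have h : ∀ z, f z ≠ 0 → ‖z‖ ≤ ρ := fun z hz => by
    have := h' (subset_tsupport _ hz)
    rw [mem_ball_zero_iff] at this
    exact this.le.trans (le_max_left _ _)
  have h1 : 0 < 1 - ρ ^ 2 := by nlinarith
  have h3 : ∀ z : ℂ, ‖z‖ ≤ ρ → 1 - ρ ^ 2 ≤ 1 - ‖z‖ ^ 2 := fun z hz => by nlinarith [norm_nonneg z]
  refine ⟨(1 - ρ ^ 2) * (1 - ρ ^ 2) / 4, by positivity, fun z hz => ?_, fun z u hu hz hzu => ?_⟩
  · have := h3 z (h z hz)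
    nlinarith
  · have hz1 : ‖z‖ < 1 := (h z hz).trans_lt hρ
    have hw1 : ‖mobius z u‖ < 1 := (h _ hzu).trans_lt hρ
    have h2 := one_sub_norm_mobius_sq hz1 hw1.le
    rw [mobius_mobius hz1 hu.le] at h2
    rw [h2]
    have h4 := norm_pos_iff.mpr (one_sub_conj_mul_ne_zero hz1 hw1.le)
    have h5 : ‖1 - conj z * mobius z u‖ ≤ 2 := by
      refine (norm_sub_le _ _).trans ?_
      rw [norm_one, norm_mul, RCLike.norm_conj]
      nlinarith [norm_nonneg z, norm_nonneg (mobius z u)]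
    have h6 := h3 z (h z hz)
    have h7 := h3 _ (h _ hzu)
    gcongr
    · nlinarith
    · nlinarith
    · nlinarith

lemma contDiff_autocorr_toDisc (hf : ContDiff ℝ (⊤ : ℕ∞) f) (hc : HasCompactSupport f)
    (hs : tsupport f ⊆ Metric.ball 0 1) :
    ContDiff ℝ (⊤ : ℕ∞) fun p => autocorr f (toDisc p) := by
  simp_rw [autocorr, integral_hypVol]
  refine contDiff_integral_of_compact (g := fun p z => (4 / (1 - ‖z‖ ^ 2) ^ 2) •
    (conj (f z) * f (mobius z (toDisc p)))) (k := tsupport f) ?_ hc.isCompact fun p z hz => ?_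
  · rw [contDiff_iff_contDiffAt]
    rintro ⟨p, z⟩
    by_cases hz : z ∈ tsupport f
    · have hz : ‖z‖ < 1 := by simpa using hs hz
      have h1 : 1 - ‖z‖ ^ 2 ≠ 0 := by nlinarith [norm_nonneg z]
      have h2 := one_sub_conj_mul_ne_zero hz (norm_toDisc_lt_one p).le
      have hconj : ContDiff ℝ (⊤ : ℕ∞) fun w : ℂ => conj w := conjCLE.contDiff
      have h3 : ContDiffAt ℝ (⊤ : ℕ∞) (fun q : ℂ × ℂ => 4 / (1 - ‖q.2‖ ^ 2) ^ 2) (p, z) := by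
        refine ContDiffAt.div contDiffAt_const (ContDiff.contDiffAt ?_) (pow_ne_zero 2 h1)
        exact (contDiff_const.sub (contDiff_snd.norm_sq ℝ)).pow 2
      have h4 : ContDiffAt ℝ (⊤ : ℕ∞) (fun q : ℂ × ℂ => mobius q.2 (toDisc q.1)) (p, z) := by
        simp only [mobius, div_eq_mul_inv]
        refine ContDiffAt.mul (ContDiff.contDiffAt ?_)
          (ContDiffAt.inv (ContDiff.contDiffAt ?_) h2)
        · exact contDiff_snd.sub (contDiff_toDisc.comp contDiff_fst)
        · exact contDiff_const.sub ((hconj.comp contDiff_snd).mul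
            (contDiff_toDisc.comp contDiff_fst))
      exact h3.smul ((hconj.comp (hf.comp contDiff_snd)).contDiffAt.mul (hf.contDiffAt.comp _ h4))
    · refine (contDiffAt_const (c := (0 : ℂ))).congr_of_eventuallyEq ?_
      have h1 : ∀ᶠ q : ℂ × ℂ in nhds (p, z), q.2 ∈ (tsupport f)ᶜ :=
        (isClosed_tsupport f).isOpen_compl.preimage continuous_snd |>.mem_nhds hz
      filter_upwards [h1] with q hq
      simp [image_eq_zero_of_notMem_tsupport hq]
  · simp [image_eq_zero_of_notMem_tsupport hz]

lemma autocorr_eq_zero {δ : ℝ}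
    (hδ : ∀ z u, ‖u‖ < 1 → f z ≠ 0 → f (mobius z u) ≠ 0 → δ ≤ 1 - ‖u‖ ^ 2)
    {u : ℂ} (hu : ‖u‖ < 1) (hu' : 1 - ‖u‖ ^ 2 < δ) : autocorr f u = 0 := by
  refine integral_eq_zero_of_ae (Filter.Eventually.of_forall fun z => ?_)
  by_contra h
  have h := mul_ne_zero_iff.mp h
  exact hu'.not_ge (hδ z u hu (fun h0 => h.1 (by simp [h0])) h.2)

lemma exists_autocorr_eq_zero (hs : tsupport f ⊆ Metric.ball 0 1) :
    ∃ M, ∀ u p, ‖u‖ = ‖toDisc p‖ → M < ‖p‖ → autocorr f u = 0 := by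
  obtain ⟨δ, hδ, -, h⟩ := exists_le_one_sub_norm_sq hs
  refine ⟨1 + 4 / δ, fun u p hu hp => autocorr_eq_zero h (hu ▸ norm_toDisc_lt_one p) ?_⟩
  rw [hu, one_sub_norm_toDisc_sq, div_lt_iff₀ (by positivity), ← div_lt_iff₀' hδ]
  have : 0 < 4 / δ := by positivity
  nlinarith

/-- The average of the autocorrelation over rotations, in the coordinate of `toDisc`. -/
def radialCorr (f : ℂ → ℂ) (p : ℂ) : ℂ := ∫ b, autocorr f (b * toDisc p) ∂circleMeasure

lemma contDiff_radialCorr (hf : ContDiff ℝ (⊤ : ℕ∞) f) (hc : HasCompactSupport f)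
    (hs : tsupport f ⊆ Metric.ball 0 1) : ContDiff ℝ (⊤ : ℕ∞) (radialCorr f) := by
  have hk := contDiff_autocorr_toDisc hf hc hs
  have hm := measurable_autocorr hf.continuous.measurable
  let χ : ContDiffBump Real.pi := ⟨Real.pi, Real.pi + 1, Real.pi_pos, by linarith⟩
  have h1 : radialCorr f = fun p => (2 * Real.pi : ℂ)⁻¹ *
      ∫ θ in Set.Ioc (0 : ℝ) (2 * Real.pi), (χ θ : ℂ) * autocorr f (toDisc (cexp (θ * I) * p)) := by
    ext p
    have hm' : Measurable fun b => autocorr f (b * toDisc p) := hm.comp (measurable_mul_const _)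
    rw [radialCorr, integral_circleMeasure hm', intervalIntegral.integral_of_le Real.two_pi_pos.le]
    congr 1
    refine setIntegral_congr_fun measurableSet_Ioc fun θ hθ => ?_
    have h2 : χ θ = 1 := χ.one_of_mem_closedBall (by
      rw [Metric.mem_closedBall, Real.dist_eq, abs_le]
      change -Real.pi ≤ _ ∧ _ ≤ Real.pi
      constructor <;> linarith [hθ.1, hθ.2])
    simp only [h2, mul_toDisc (Complex.norm_exp_ofReal_mul_I θ), ofReal_one, one_mul]
  rw [h1]
  refine contDiff_const.mul (contDiff_integral_of_compact
    (g := fun p θ => (χ θ : ℂ) * autocorr f (toDisc (cexp (θ * I) * p)))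
    ?_ χ.hasCompactSupport.isCompact fun p θ hθ => ?_)
  · refine (ofRealCLM.contDiff.comp (χ.contDiff.comp contDiff_snd)).mul (hk.comp
      (ContDiff.mul (ContDiff.cexp ?_) contDiff_fst))
    exact (ofRealCLM.contDiff.comp contDiff_snd).mul contDiff_const
  · simp [image_eq_zero_of_notMem_tsupport hθ]

lemma hasCompactSupport_radialCorr (hs : tsupport f ⊆ Metric.ball 0 1) :
    HasCompactSupport (radialCorr f) := by
  obtain ⟨M, hM⟩ := exists_autocorr_eq_zero hs
  refine HasCompactSupport.intro (isCompact_closedBall (0 : ℂ) M) fun p hp => ?_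
  refine integral_eq_zero_of_ae ?_
  filter_upwards [ae_circleMeasure] with b hb
  rw [mul_toDisc hb]
  exact hM _ _ rfl (by simpa [hb] using hp)

lemma radialCorr_mul (hf : Measurable f) {c : ℂ} (hc : ‖c‖ = 1) (u : ℂ) :
    ∫ b, autocorr f (b * (c * u)) ∂circleMeasure = ∫ b, autocorr f (b * u) ∂circleMeasure := by
  have := integral_circleMeasure_mul (g := fun b => autocorr f (b * u))
    ((measurable_autocorr hf).comp (measurable_mul_const _)) hc
  rw [← this]
  refine integral_congr_ae (Filter.Eventually.of_forall fun b => ?_)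
  simp only
  congr 1
  ring

lemma integral_autocorr_mul_congr (hf : Measurable f) {u v : ℂ} (h : ‖u‖ = ‖v‖) :
    ∫ b, autocorr f (b * u) ∂circleMeasure = ∫ b, autocorr f (b * v) ∂circleMeasure := by
  rw [← norm_mul_exp_arg_mul_I u, ← norm_mul_exp_arg_mul_I v, h, mul_comm, mul_comm (‖v‖ : ℂ),
    radialCorr_mul hf (Complex.norm_exp_ofReal_mul_I _),
    radialCorr_mul hf (Complex.norm_exp_ofReal_mul_I _)]

lemma radialCorr_radial (hf : Measurable f) (p : ℂ) : radialCorr f p = radialCorr f ‖p‖ :=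
  integral_autocorr_mul_congr hf (by simp [toDisc])

lemma radialCorr_zero : radialCorr f 0 = ((∫ z, ‖f z‖ ^ 2 ∂hypVol : ℝ) : ℂ) := by
  simp [radialCorr, toDisc_zero, autocorr_zero]

end Autocorr

/-- The Helgason–Fourier transform on the disc. -/
def hypFourier (f : ℂ → ℂ) (r : ℝ) (b : ℂ) : ℂ :=
  ∫ w, f w * (Pk w b : ℂ) ^ ((1 : ℂ) / 2 + I * r) ∂hypVol

lemma Pk_pos {u b : ℂ} (hu : ‖u‖ < 1) (hb : ‖b‖ = 1) : 0 < Pk u b := by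
  have h1 : 0 < 1 - ‖u‖ ^ 2 := by nlinarith [norm_nonneg u]
  have h2 : 0 < ‖u - b‖ := norm_pos_iff.mpr fun h => by
    rw [sub_eq_zero.mp h, hb] at hu
    exact lt_irrefl _ hu
  unfold Pk
  positivity

lemma exists_Pk_le {δ : ℝ} (hδ : 0 < δ) : ∃ B, 0 ≤ B ∧ ∀ u b : ℂ, ‖b‖ = 1 → δ ≤ 1 - ‖u‖ ^ 2 →
    ‖(Pk u b : ℂ)‖ ≤ B ∧ ∀ r : ℝ, ‖(Pk u b : ℂ) ^ ((1 : ℂ) / 2 + I * r)‖ ≤ B := by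
  refine ⟨1 + ((δ / 2) ^ 2)⁻¹, by positivity, fun u b hb hu => ?_⟩
  have hu1 : ‖u‖ < 1 := by nlinarith [norm_nonneg u]
  have hp := Pk_pos hu1 hb
  have h1 : δ / 2 ≤ ‖u - b‖ := by
    have := norm_sub_norm_le b u
    rw [hb, norm_sub_rev] at this
    nlinarith [norm_nonneg u]
  have h2 : Pk u b ≤ 1 + ((δ / 2) ^ 2)⁻¹ := by
    have h3 : Pk u b ≤ 1 / (δ / 2) ^ 2 := by
      unfold Pk
      gcongr
      nlinarith [norm_nonneg u]
    rw [one_div] at h3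
    linarith
  refine ⟨by rwa [norm_real, Real.norm_eq_abs, abs_of_pos hp], fun r => ?_⟩
  rw [norm_cpow_eq_rpow_re_of_pos hp]
  have h4 : ((1 : ℂ) / 2 + I * r).re = 1 / 2 := by simp
  rw [h4]
  have h5 : (1 : ℝ) ≤ 1 + ((δ / 2) ^ 2)⁻¹ := by
    have : 0 < ((δ / 2) ^ 2)⁻¹ := by positivity
    linarith
  calc Pk u b ^ (1 / 2 : ℝ) ≤ (1 + ((δ / 2) ^ 2)⁻¹) ^ (1 / 2 : ℝ) := by gcongr
    _ ≤ (1 + ((δ / 2) ^ 2)⁻¹) ^ (1 : ℝ) :=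
      Real.rpow_le_rpow_of_exponent_le h5 (by norm_num)
    _ = _ := Real.rpow_one _

lemma Pk_cpow_mobius {z u b : ℂ} (hz : ‖z‖ < 1) (hu : ‖u‖ < 1) (hb : ‖b‖ = 1) (r : ℝ) :
    conj ((Pk z b : ℂ) ^ ((1 : ℂ) / 2 + I * r)) * (Pk (mobius z u) b : ℂ) ^ ((1 : ℂ) / 2 + I * r) =
      Pk z b * (Pk u (mobius z b) : ℂ) ^ ((1 : ℂ) / 2 + I * r) := by
  have h1 := Pk_pos hz hb
  have h2 := Pk_pos hu (norm_mobius_eq_one hz hb)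
  have h3 : conj ((Pk z b : ℂ) ^ ((1 : ℂ) / 2 + I * r)) = (Pk z b : ℂ) ^ ((1 : ℂ) / 2 - I * r) := by
    have h4 : (1 : ℂ) / 2 - I * r = conj ((1 : ℂ) / 2 + I * r) := by
      simp only [map_add, map_mul, conj_I, conj_ofReal, map_div₀, map_one, map_ofNat]
      ring
    rw [h4, cpow_conj _ _ (by rw [arg_ofReal_of_nonneg h1.le]; exact Real.pi_ne_zero.symm),
      conj_ofReal]
  rw [h3, Pk_mobius hz hu hb, ofReal_mul, mul_cpow_ofReal_nonneg h1.le h2.le, ← mul_assoc,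
    ← cpow_add _ _ (ofReal_ne_zero.mpr h1.ne')]
  congr 1
  ring_nf
  rw [cpow_one]

@[fun_prop]
lemma measurable_Pk_cpow (r : ℝ) :
    Measurable fun q : ℂ × ℂ => (Pk q.1 q.2 : ℂ) ^ ((1 : ℂ) / 2 + I * r) :=
  (measurable_ofReal.comp measurable_Pk).pow_const _

lemma continuous_Pk_cpow_exp {u : ℂ} (hu : ‖u‖ < 1) (r : ℝ) :
    Continuous fun θ : ℝ => (Pk u (cexp (θ * I)) : ℂ) ^ ((1 : ℂ) / 2 + I * r) :=
  (continuous_ofReal.comp (continuous_Pk_exp hu)).cpow continuous_const fun θ =>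
    ofReal_mem_slitPlane.mpr (Pk_pos hu (Complex.norm_exp_ofReal_mul_I θ))

lemma integral_Pk_mul_cpow_mobius {z u : ℂ} (hz : ‖z‖ < 1) (hu : ‖u‖ < 1) (r : ℝ) :
    ∫ b, Pk z b * (Pk u (mobius z b) : ℂ) ^ ((1 : ℂ) / 2 + I * r) ∂circleMeasure =
      ∫ b, (Pk u b : ℂ) ^ ((1 : ℂ) / 2 + I * r) ∂circleMeasure := by
  have h : Measurable fun b => (Pk u b : ℂ) ^ ((1 : ℂ) / 2 + I * r) :=
    (measurable_Pk_cpow r).comp (f := fun b : ℂ => (u, b)) (by fun_prop)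
  exact integral_Pk_mul_comp_mobius hz h (continuous_Pk_cpow_exp hu r)

section Plancherel

variable {f : ℂ → ℂ}

lemma integrable_hypVol (hf : Continuous f) (hc : HasCompactSupport f)
    (hs : tsupport f ⊆ Metric.ball 0 1) : Integrable f hypVol := by
  obtain ⟨δ, hδ, h1, -⟩ := exists_le_one_sub_norm_sq hs
  obtain ⟨C, hC⟩ := hc.exists_bound_of_continuous hf
  exact integrable_of_ae_bounded hf.aestronglyMeasurable (measurableSet_one_sub_norm_sq δ)
    (hypVol_one_sub_norm_sq_ne_top hδ)
    (Filter.Eventually.of_forall fun z hz => not_imp_comm.mp (h1 z) hz)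
    (Filter.Eventually.of_forall hC)

lemma norm_autocorr_le (hf : Continuous f) (hc : HasCompactSupport f)
    (hs : tsupport f ⊆ Metric.ball 0 1) : ∃ C, ∀ u, ‖autocorr f u‖ ≤ C := by
  obtain ⟨C, hC⟩ := hc.exists_bound_of_continuous hf
  refine ⟨∫ z, ‖f z‖ * C ∂hypVol, fun u => norm_integral_le_of_norm_le
    ((integrable_hypVol hf hc hs).norm.mul_const C) (Filter.Eventually.of_forall fun z => ?_)⟩
  rw [norm_mul, RCLike.norm_conj]
  gcongr
  exact hC _

lemma integrable_correlation_mul (hf : Continuous f) (hc : HasCompactSupport f)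
    (hs : tsupport f ⊆ Metric.ball 0 1) {W : ℂ × ℂ × ℂ → ℂ} (hW : Measurable W)
    (hb : ∀ δ, 0 < δ → ∃ B, 0 ≤ B ∧ ∀ b z u, ‖b‖ = 1 → δ ≤ 1 - ‖z‖ ^ 2 → δ ≤ 1 - ‖u‖ ^ 2 →
      ‖W (b, z, u)‖ ≤ B) :
    Integrable (fun q : ℂ × ℂ × ℂ => conj (f q.2.1) * f (mobius q.2.1 q.2.2) * W q)
      (circleMeasure.prod (hypVol.prod hypVol)) := by
  obtain ⟨δ, hδ, h1, h2⟩ := exists_le_one_sub_norm_sq hs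
  obtain ⟨C, hC⟩ := hc.exists_bound_of_continuous hf
  obtain ⟨B, hB0, hB⟩ := hb δ hδ
  have hb : ∀ᵐ q : ℂ × ℂ × ℂ ∂circleMeasure.prod (hypVol.prod hypVol), ‖q.1‖ = 1 :=
    Measure.quasiMeasurePreserving_fst.ae ae_circleMeasure
  have hu : ∀ᵐ q : ℂ × ℂ × ℂ ∂circleMeasure.prod (hypVol.prod hypVol), ‖q.2.2‖ < 1 :=
    Measure.quasiMeasurePreserving_snd.ae (Measure.quasiMeasurePreserving_snd.ae ae_hypVol)
  have hm : Measurable fun q : ℂ × ℂ × ℂ => conj (f q.2.1) * f (mobius q.2.1 q.2.2) * W q := by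
    refine ((Complex.continuous_conj.measurable.comp (hf.measurable.comp (by fun_prop))).mul
      (hf.measurable.comp ?_)).mul hW
    exact measurable_mobius.comp measurable_snd
  have hzero : ∀ q : ℂ × ℂ × ℂ, ‖q.2.2‖ < 1 →
      conj (f q.2.1) * f (mobius q.2.1 q.2.2) * W q ≠ 0 →
      δ ≤ 1 - ‖q.2.1‖ ^ 2 ∧ δ ≤ 1 - ‖q.2.2‖ ^ 2 := by
    intro q hq h
    have h := mul_ne_zero_iff.mp (mul_ne_zero_iff.mp h).1
    have h3 : f q.2.1 ≠ 0 := fun h0 => h.1 (by simp [h0])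
    exact ⟨h1 _ h3, h2 _ _ hq h3 h.2⟩
  refine integrable_of_ae_bounded hm.aestronglyMeasurable
    (MeasurableSet.univ.prod ((measurableSet_one_sub_norm_sq δ).prod
      (measurableSet_one_sub_norm_sq δ))) ?_ ?_ (C := C * C * B) ?_
  · rw [Measure.prod_prod, Measure.prod_prod, measure_univ, one_mul]
    exact ENNReal.mul_ne_top (hypVol_one_sub_norm_sq_ne_top hδ) (hypVol_one_sub_norm_sq_ne_top hδ)
  · filter_upwards [hu] with q hq hS
    by_contra h
    exact hS ⟨Set.mem_univ _, hzero q hq h⟩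
  · filter_upwards [hb, hu] with q hq1 hq2
    have hC0 : 0 ≤ C := (norm_nonneg _).trans (hC 0)
    by_cases h : conj (f q.2.1) * f (mobius q.2.1 q.2.2) * W q = 0
    · rw [h, norm_zero]
      positivity
    · have h3 := hzero q hq2 h
      rw [norm_mul, norm_mul, RCLike.norm_conj]
      gcongr
      · exact hC _
      · exact hC _
      · exact hB q.1 q.2.1 q.2.2 hq1 h3.1 h3.2

lemma integrable_correlation_mul_Pk_mobius (hf : Continuous f) (hc : HasCompactSupport f)
    (hs : tsupport f ⊆ Metric.ball 0 1) (r : ℝ) :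
    Integrable (fun q : ℂ × ℂ × ℂ => conj (f q.2.1) * f (mobius q.2.1 q.2.2) *
      (Pk q.2.1 q.1 * (Pk q.2.2 (mobius q.2.1 q.1) : ℂ) ^ ((1 : ℂ) / 2 + I * r)))
      (circleMeasure.prod (hypVol.prod hypVol)) := by
  have h1 : Measurable fun q : ℂ × ℂ × ℂ => (Pk q.2.1 q.1 : ℂ) :=
    measurable_ofReal.comp (measurable_Pk.comp (g := fun q : ℂ × ℂ => Pk q.1 q.2)
      (f := fun q : ℂ × ℂ × ℂ => (q.2.1, q.1)) (by fun_prop))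
  have h2 : Measurable fun q : ℂ × ℂ × ℂ => mobius q.2.1 q.1 :=
    measurable_mobius.comp (f := fun q : ℂ × ℂ × ℂ => (q.2.1, q.1)) (by fun_prop)
  have h3 : Measurable fun q : ℂ × ℂ × ℂ =>
      (Pk q.2.2 (mobius q.2.1 q.1) : ℂ) ^ ((1 : ℂ) / 2 + I * r) :=
    (measurable_Pk_cpow r).comp (f := fun q : ℂ × ℂ × ℂ => (q.2.2, mobius q.2.1 q.1))
      (measurable_snd.snd.prodMk h2)
  refine integrable_correlation_mul hf hc hs (h1.mul h3) fun δ hδ => ?_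
  obtain ⟨B, hB0, hB⟩ := exists_Pk_le hδ
  refine ⟨B * B, by positivity, fun b z u hb hz hu => ?_⟩
  have hz1 : ‖z‖ < 1 := by nlinarith [norm_nonneg z]
  simp only [norm_mul]
  exact mul_le_mul (hB z b hb hz).1 ((hB u _ (norm_mobius_eq_one hz1 hb) hu).2 r)
    (norm_nonneg _) hB0

lemma integrable_correlation_mul_Pk (hf : Continuous f) (hc : HasCompactSupport f)
    (hs : tsupport f ⊆ Metric.ball 0 1) (r : ℝ) :
    Integrable (fun q : ℂ × ℂ × ℂ => conj (f q.2.1) * f (mobius q.2.1 q.2.2) *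
      (Pk q.2.2 q.1 : ℂ) ^ ((1 : ℂ) / 2 + I * r))
      (circleMeasure.prod (hypVol.prod hypVol)) := by
  have h1 : Measurable fun q : ℂ × ℂ × ℂ => (Pk q.2.2 q.1 : ℂ) ^ ((1 : ℂ) / 2 + I * r) :=
    (measurable_Pk_cpow r).comp (f := fun q : ℂ × ℂ × ℂ => (q.2.2, q.1)) (by fun_prop)
  refine integrable_correlation_mul hf hc hs h1 fun δ hδ => ?_
  obtain ⟨B, hB0, hB⟩ := exists_Pk_le hδ
  exact ⟨B, hB0, fun b z u hb hz hu => (hB u b hb hu).2 r⟩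

lemma conj_hypFourier_mul (r : ℝ) {b : ℂ} (hb : ‖b‖ = 1) :
    conj (hypFourier f r b) * hypFourier f r b = ∫ z, ∫ u, conj (f z) * f (mobius z u) *
      (Pk z b * (Pk u (mobius z b) : ℂ) ^ ((1 : ℂ) / 2 + I * r)) ∂hypVol ∂hypVol := by
  conv_lhs => enter [1]; rw [hypFourier, ← integral_conj]
  rw [← integral_mul_const]
  refine integral_congr_ae ?_
  filter_upwards [ae_hypVol] with z hz
  rw [hypFourier, ← integral_mobius hz, ← integral_const_mul]
  refine integral_congr_ae ?_
  filter_upwards [ae_hypVol] with u hu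
  rw [← Pk_cpow_mobius hz hu hb, map_mul]
  ring

/-- The integral of `|hypFourier f|²` over the boundary is the spherical transform of the
autocorrelation. -/
lemma integral_conj_hypFourier_mul (hf : Continuous f) (hc : HasCompactSupport f)
    (hs : tsupport f ⊆ Metric.ball 0 1) (r : ℝ) :
    ∫ b, conj (hypFourier f r b) * hypFourier f r b ∂circleMeasure =
      ∫ b, (∫ t : ℝ, ∫ s : ℝ, cexp (I * r * t) * autocorr f (horo b t s)) ∂circleMeasure := by
  have hT1 := integrable_correlation_mul_Pk_mobius hf hc hs r
  have hT2 := integrable_correlation_mul_Pk hf hc hs r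
  have hdisc : ∀ᵐ q : ℂ × ℂ ∂hypVol.prod hypVol, ‖q.1‖ < 1 ∧ ‖q.2‖ < 1 :=
    (Measure.quasiMeasurePreserving_fst.ae ae_hypVol).and
      (Measure.quasiMeasurePreserving_snd.ae ae_hypVol)
  calc ∫ b, conj (hypFourier f r b) * hypFourier f r b ∂circleMeasure
    _ = ∫ b, ∫ q : ℂ × ℂ, conj (f q.1) * f (mobius q.1 q.2) *
          (Pk q.1 b * (Pk q.2 (mobius q.1 b) : ℂ) ^ ((1 : ℂ) / 2 + I * r))
          ∂hypVol.prod hypVol ∂circleMeasure := by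
        refine integral_congr_ae ?_
        filter_upwards [ae_circleMeasure, hT1.prod_right_ae] with b hb hi
        rw [conj_hypFourier_mul r hb, integral_prod _ hi]
    _ = ∫ q : ℂ × ℂ, ∫ b, conj (f q.1) * f (mobius q.1 q.2) *
          (Pk q.1 b * (Pk q.2 (mobius q.1 b) : ℂ) ^ ((1 : ℂ) / 2 + I * r))
          ∂circleMeasure ∂hypVol.prod hypVol := integral_integral_swap hT1
    _ = ∫ q : ℂ × ℂ, ∫ b, conj (f q.1) * f (mobius q.1 q.2) *
          (Pk q.2 b : ℂ) ^ ((1 : ℂ) / 2 + I * r) ∂circleMeasure ∂hypVol.prod hypVol := by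
        refine integral_congr_ae ?_
        filter_upwards [hdisc] with q hq
        rw [integral_const_mul, integral_const_mul, integral_Pk_mul_cpow_mobius hq.1 hq.2]
    _ = ∫ b, ∫ q : ℂ × ℂ, conj (f q.1) * f (mobius q.1 q.2) *
          (Pk q.2 b : ℂ) ^ ((1 : ℂ) / 2 + I * r) ∂hypVol.prod hypVol ∂circleMeasure :=
        (integral_integral_swap hT2).symm
    _ = _ := by
        refine integral_congr_ae ?_
        filter_upwards [ae_circleMeasure, hT2.prod_right_ae] with b hb hi
        have h1 : ∀ u, ∫ z, conj (f z) * f (mobius z u) * (Pk u b : ℂ) ^ ((1 : ℂ) / 2 + I * r)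
            ∂hypVol = autocorr f u * (Pk u b : ℂ) ^ ((1 : ℂ) / 2 + I * r) := fun u => by
          rw [integral_mul_const, autocorr]
        have hi2 := hi.integral_prod_right
        rw [integral_prod_symm _ hi]
        simp only [h1] at hi2 ⊢
        rw [integral_horo hb hi2]
        refine integral_congr_ae (Filter.Eventually.of_forall fun t => ?_)
        simp only [Pk_horo hb]
        rw [integral_mul_const, integral_const_mul, real_smul, mul_comm (∫ s : ℝ, _), ← mul_assoc]
        congr 1
        rw [cpow_def_of_ne_zero (by simp), ← ofReal_log (Real.exp_pos t).le, Real.log_exp,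
          ofReal_exp, ← Complex.exp_add]
        congr 1
        push_cast
        ring

lemma integrable_autocorr_horo (hf : Continuous f) (hc : HasCompactSupport f)
    (hs : tsupport f ⊆ Metric.ball 0 1) (r : ℝ) :
    Integrable (fun q : ℂ × ℝ × ℝ => cexp (I * r * q.2.1) * autocorr f (horo q.1 q.2.1 q.2.2))
      (circleMeasure.prod (volume.prod volume)) := by
  obtain ⟨M, hM⟩ := exists_autocorr_eq_zero hs
  obtain ⟨C, hC⟩ := norm_autocorr_le hf hc hs
  have hm : Measurable fun q : ℂ × ℝ × ℝ =>
      cexp (I * r * q.2.1) * autocorr f (horo q.1 q.2.1 q.2.2) := by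
    refine Measurable.mul (by fun_prop) ((measurable_autocorr hf.measurable).comp ?_)
    unfold horo cayley
    fun_prop
  have hb : ∀ᵐ q : ℂ × ℝ × ℝ ∂circleMeasure.prod (volume.prod volume), ‖q.1‖ = 1 :=
    Measure.quasiMeasurePreserving_fst.ae ae_circleMeasure
  refine integrable_of_ae_bounded hm.aestronglyMeasurable
    (MeasurableSet.univ.prod (measurableSet_closedBall (x := (0 : ℝ × ℝ)) (ε := M))) ?_ ?_
    (C := C) (Filter.Eventually.of_forall fun q => ?_)
  · rw [Measure.prod_prod, measure_univ, one_mul]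
    exact (isCompact_closedBall _ _).measure_ne_top
  · filter_upwards [hb] with q hq hS
    have h1 : M < ‖q.2‖ := by
      by_contra h
      exact hS ⟨Set.mem_univ _, by simpa using h⟩
    rw [hM _ _ (norm_horo hq q.2.1 q.2.2) (h1.trans_le (norm_le_norm_two_sinh_add_mul_I q.2)),
      mul_zero]
  · rw [norm_mul, show (I * r * q.2.1 : ℂ) = (r * q.2.1 : ℝ) * I by push_cast; ring,
      Complex.norm_exp_ofReal_mul_I, one_mul]
    exact hC _

lemma integral_norm_hypFourier_sq (hf : Continuous f) (hc : HasCompactSupport f)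
    (hs : tsupport f ⊆ Metric.ball 0 1) (r : ℝ) :
    ((∫ b, ‖hypFourier f r b‖ ^ 2 ∂circleMeasure : ℝ) : ℂ) =
      ∫ t : ℝ, cexp (I * r * t) *
        ∫ s : ℝ, radialCorr f ((2 * Real.sinh (t / 2) : ℝ) + s * I) := by
  have hT := integrable_autocorr_horo hf hc hs r
  calc ((∫ b, ‖hypFourier f r b‖ ^ 2 ∂circleMeasure : ℝ) : ℂ)
    _ = ∫ b, conj (hypFourier f r b) * hypFourier f r b ∂circleMeasure := by
        rw [← integral_complex_ofReal]
        simp_rw [conj_mul', ofReal_pow]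
    _ = ∫ b, (∫ t : ℝ, ∫ s : ℝ, cexp (I * r * t) * autocorr f (horo b t s)) ∂circleMeasure :=
        integral_conj_hypFourier_mul hf hc hs r
    _ = ∫ b, ∫ q : ℝ × ℝ, cexp (I * r * q.1) * autocorr f (horo b q.1 q.2)
          ∂volume.prod volume ∂circleMeasure := by
        refine integral_congr_ae ?_
        filter_upwards [hT.prod_right_ae] with b hi
        rw [integral_prod _ hi]
    _ = ∫ q : ℝ × ℝ, ∫ b, cexp (I * r * q.1) * autocorr f (horo b q.1 q.2)
          ∂circleMeasure ∂volume.prod volume := integral_integral_swap hT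
    _ = ∫ t : ℝ, ∫ s : ℝ, ∫ b, cexp (I * r * t) * autocorr f (horo b t s) ∂circleMeasure :=
        integral_prod _ hT.integral_prod_right
    _ = _ := by
        refine integral_congr_ae (Filter.Eventually.of_forall fun t => ?_)
        simp only
        rw [← integral_const_mul]
        refine integral_congr_ae (Filter.Eventually.of_forall fun s => ?_)
        simp only
        rw [integral_const_mul, radialCorr, ← integral_autocorr_mul_congr hf.measurable
          (norm_horo norm_one t s)]
        simp only [horo, cayley, one_mul]

end Plancherel

section Isometry

variable {f : ℂ → ℂ}

lemma plancherelDensity_nonneg {r : ℝ} (hr : 0 < r) :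
    0 ≤ (2 * Real.pi)⁻¹ * r * Real.tanh (Real.pi * r) := by
  have h := Real.pi_pos
  have h1 : 0 ≤ Real.tanh (Real.pi * r) := by
    rw [Real.tanh_eq_sinh_div_cosh]
    exact div_nonneg (Real.sinh_nonneg_iff.mpr (by positivity)) (Real.cosh_pos _).le
  positivity

lemma continuous_plancherelDensity :
    Continuous fun r : ℝ => (2 * Real.pi)⁻¹ * r * Real.tanh (Real.pi * r) := by
  simp_rw [Real.tanh_eq_sinh_div_cosh]
  exact (by fun_prop : Continuous fun r : ℝ => (2 * Real.pi)⁻¹ * r).mul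
    ((Real.continuous_sinh.comp (by fun_prop)).div (Real.continuous_cosh.comp (by fun_prop))
      fun r => (Real.cosh_pos _).ne')

lemma measurable_hypFourier (hf : Measurable f) :
    Measurable fun q : ℂ × ℝ => hypFourier f q.2 q.1 := by
  have h1 : Measurable fun q : (ℂ × ℝ) × ℂ => (Pk q.2 q.1.1 : ℂ) :=
    measurable_ofReal.comp (measurable_Pk.comp (g := fun q : ℂ × ℂ => Pk q.1 q.2)
      (f := fun q : (ℂ × ℝ) × ℂ => (q.2, q.1.1)) (by fun_prop))
  have h2 : Measurable fun q : (ℂ × ℝ) × ℂ =>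
      f q.2 * (Pk q.2 q.1.1 : ℂ) ^ ((1 : ℂ) / 2 + I * q.1.2) :=
    (hf.comp measurable_snd).mul (h1.pow (by fun_prop))
  exact h2.stronglyMeasurable.integral_prod_right.measurable

lemma norm_hypFourier_le (hf : Continuous f) (hc : HasCompactSupport f)
    (hs : tsupport f ⊆ Metric.ball 0 1) :
    ∃ C, ∀ (r : ℝ) (b : ℂ), ‖b‖ = 1 → ‖hypFourier f r b‖ ≤ C := by
  obtain ⟨δ, hδ, h1, -⟩ := exists_le_one_sub_norm_sq hs
  obtain ⟨B, hB0, hB⟩ := exists_Pk_le hδ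
  refine ⟨∫ z, ‖f z‖ * B ∂hypVol, fun r b hb => norm_integral_le_of_norm_le
    ((integrable_hypVol hf hc hs).norm.mul_const B) (Filter.Eventually.of_forall fun z => ?_)⟩
  rw [norm_mul]
  by_cases h : f z = 0
  · simp [h]
  · gcongr
    exact (hB z b hb (h1 z h)).2 r

lemma integrable_norm_hypFourier_sq (hf : ContDiff ℝ (⊤ : ℕ∞) f) (hc : HasCompactSupport f)
    (hs : tsupport f ⊆ Metric.ball 0 1) :
    Integrable (fun q : ℂ × ℝ => ‖hypFourier f q.2 q.1‖ ^ 2 *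
      ((2 * Real.pi)⁻¹ * q.2 * Real.tanh (Real.pi * q.2)))
      (circleMeasure.prod (volume.restrict (Set.Ioi 0))) := by
  obtain ⟨C, hC⟩ := norm_hypFourier_le hf.continuous hc hs
  have hF := measurable_hypFourier hf.continuous.measurable
  have hm : Measurable (fun q : ℂ × ℝ => ‖hypFourier f q.2 q.1‖ ^ 2 *
      ((2 * Real.pi)⁻¹ * q.2 * Real.tanh (Real.pi * q.2))) :=
    (hF.norm.pow_const 2).mul (continuous_plancherelDensity.measurable.comp measurable_snd)
  rw [integrable_prod_iff' hm.aestronglyMeasurable]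
  refine ⟨Filter.Eventually.of_forall fun r => ?_, ?_⟩
  · simp only
    refine Integrable.mul_const ?_ _
    have h1 : Measurable fun b => ‖hypFourier f r b‖ ^ 2 :=
      (hF.comp (measurable_prodMk_right (y := r))).norm.pow_const 2
    refine Integrable.of_bound h1.aestronglyMeasurable (C ^ 2) ?_
    filter_upwards [ae_circleMeasure] with b hb
    rw [norm_pow, norm_norm]
    gcongr
    exact hC r b hb
  · have hI := (integrable_expTransform_radon_mul (contDiff_radialCorr hf hc hs)
      (hasCompactSupport_radialCorr hs)).norm
    refine hI.congr ?_
    filter_upwards [ae_restrict_mem measurableSet_Ioi] with r hr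
    rw [← integral_norm_hypFourier_sq hf.continuous hc hs r, ← ofReal_mul, norm_real,
      Real.norm_eq_abs, abs_of_nonneg, ← integral_mul_const]
    · refine integral_congr_ae (Filter.Eventually.of_forall fun b => ?_)
      simp only
      rw [Real.norm_eq_abs, abs_of_nonneg]
      exact mul_nonneg (by positivity) (plancherelDensity_nonneg hr)
    · exact mul_nonneg (integral_nonneg fun b => by positivity) (plancherelDensity_nonneg hr)

/-- The Plancherel formula for the Helgason–Fourier transform on the disc. -/
theorem integral_integral_norm_hypFourier_sq (hf : ContDiff ℝ (⊤ : ℕ∞) f)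
    (hc : HasCompactSupport f) (hs : tsupport f ⊆ Metric.ball 0 1) :
    ∫ b, (∫ r in Set.Ioi (0 : ℝ), ‖hypFourier f r b‖ ^ 2 *
      ((2 * Real.pi)⁻¹ * r * Real.tanh (Real.pi * r))) ∂circleMeasure =
      ∫ z, ‖f z‖ ^ 2 ∂hypVol := by
  rw [integral_integral_swap (integrable_norm_hypFourier_sq hf hc hs)]
  apply ofReal_injective
  rw [← radialCorr_zero, ← integral_expTransform_radon (contDiff_radialCorr hf hc hs)
    (hasCompactSupport_radialCorr hs) (radialCorr_radial hf.continuous.measurable),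
    ← integral_complex_ofReal]
  refine integral_congr_ae (Filter.Eventually.of_forall fun r => ?_)
  simp only
  rw [integral_mul_const, ofReal_mul, integral_norm_hypFourier_sq hf.continuous hc hs r]

end Isometry

lemma contDiffAt_Pk_cpow {z b : ℂ} (hz : ‖z‖ < 1) (hb : ‖b‖ = 1) (c : ℂ) :
    ContDiffAt ℝ (⊤ : ℕ∞) (fun z => (Pk z b : ℂ) ^ c) z := by
  have h1 : ContDiffAt ℝ (⊤ : ℕ∞) (fun z => Pk z b) z := by
    have h0 : ‖z - b‖ ^ 2 ≠ 0 := by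
      have : z ≠ b := by
        rintro rfl
        exact hz.ne hb
      exact pow_ne_zero 2 (norm_ne_zero_iff.mpr (sub_ne_zero.mpr this))
    exact (contDiffAt_const.sub (contDiff_id.norm_sq ℝ).contDiffAt).div
      ((contDiff_id.sub contDiff_const).norm_sq ℝ).contDiffAt h0
  have h2 : ContDiffAt ℝ (⊤ : ℕ∞) (fun x : ℂ => x ^ c) (Pk z b : ℂ) :=
    ((analyticAt_id.cpow analyticAt_const
      (ofReal_mem_slitPlane.mpr (Pk_pos hz hb))).contDiffAt (n := (⊤ : ℕ∞))).restrict_scalars ℝ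
  exact h2.comp (f := fun z => (Pk z b : ℂ)) z (ofRealCLM.contDiff.contDiffAt.comp z h1)

lemma norm_mul_Pk_cpow_sq {z b : ℂ} (hz : ‖z‖ < 1) (hb : ‖b‖ = 1) (r : ℝ) (x : ℂ) :
    ‖x * (Pk z b : ℂ) ^ ((1 : ℂ) / 2 + I * r)‖ ^ 2 = ‖x‖ ^ 2 * Pk z b := by
  have hp := Pk_pos hz hb
  rw [norm_mul, mul_pow, norm_cpow_eq_rpow_re_of_pos hp, ← Real.rpow_natCast (_ ^ _),
    ← Real.rpow_mul hp.le]
  simp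

section Symbol

variable {a : ℂ → ℂ → ℝ → ℂ}

lemma tsupport_slice_subset {b : ℂ} {r : ℝ} (c : ℂ) :
    tsupport (fun z => a z b r * (Pk z b : ℂ) ^ c) ⊆
      {z | (z, b, r) ∈ tsupport fun p : ℂ × ℂ × ℝ => a p.1 p.2.1 p.2.2} := by
  refine closure_minimal (fun z hz => subset_tsupport _ ?_)
    ((isClosed_tsupport _).preimage (by fun_prop))
  exact left_ne_zero_of_mul hz

lemma contDiff_slice (hsm : ContDiff ℝ (⊤ : ℕ∞) fun p : ℂ × ℂ × ℝ => a p.1 p.2.1 p.2.2)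
    (hsupp : ∀ p ∈ tsupport (fun p : ℂ × ℂ × ℝ => a p.1 p.2.1 p.2.2), ‖p.1‖ < 1)
    {b : ℂ} (hb : ‖b‖ = 1) (r : ℝ) (c : ℂ) :
    ContDiff ℝ (⊤ : ℕ∞) fun z => a z b r * (Pk z b : ℂ) ^ c := by
  rw [contDiff_iff_contDiffAt]
  intro z
  by_cases hz : ‖z‖ < 1
  · have h1 : ContDiff ℝ (⊤ : ℕ∞) fun z => a z b r :=
      hsm.comp (f := fun z : ℂ => (z, b, r)) (by fun_prop)
    exact h1.contDiffAt.mul (contDiffAt_Pk_cpow hz hb c)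
  · have h1 : z ∉ tsupport (fun z => a z b r * (Pk z b : ℂ) ^ c) := fun h =>
      hz (hsupp _ (tsupport_slice_subset c h))
    exact contDiffAt_const.congr_of_eventuallyEq (notMem_tsupport_iff_eventuallyEq.mp h1)

lemma hasCompactSupport_slice
    (hcs : HasCompactSupport fun p : ℂ × ℂ × ℝ => a p.1 p.2.1 p.2.2) (b : ℂ) (r : ℝ) (c : ℂ) :
    HasCompactSupport fun z => a z b r * (Pk z b : ℂ) ^ c :=
  (hcs.isCompact.image continuous_fst).of_isClosed_subset (isClosed_tsupport _) fun z hz =>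
    ⟨(z, b, r), tsupport_slice_subset c hz, rfl⟩

lemma integrable_norm_sq_mul_Pk (ha : Continuous fun p : ℂ × ℂ × ℝ => a p.1 p.2.1 p.2.2)
    (hcs : HasCompactSupport fun p : ℂ × ℂ × ℝ => a p.1 p.2.1 p.2.2)
    (hsupp : ∀ p ∈ tsupport (fun p : ℂ × ℂ × ℝ => a p.1 p.2.1 p.2.2), ‖p.1‖ < 1) :
    Integrable (fun p : ℂ × ℂ × ℝ => ‖a p.1 p.2.1 p.2.2‖ ^ 2 * Pk p.1 p.2.1 *
      ((2 * Real.pi)⁻¹ * p.2.2 * Real.tanh (Real.pi * p.2.2)))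
      (hypVol.prod (circleMeasure.prod (volume.restrict (Set.Ioi 0)))) := by
  obtain ⟨ρ, hρ, h⟩ := exists_lt_subset_ball
    (hcs.isCompact.image continuous_fst).isClosed (x := 0) (r := 1) (by
      rintro _ ⟨p, hp, rfl⟩
      simpa using hsupp p hp)
  obtain ⟨R, hR0, hR⟩ := hcs.isCompact.isBounded.exists_pos_norm_le
  obtain ⟨C, hC⟩ := hcs.exists_bound_of_continuous ha
  obtain ⟨D, hD⟩ := (isCompact_closedBall (0 : ℝ) R).exists_bound_of_continuousOn
    continuous_plancherelDensity.continuousOn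
  have hδ : 0 < 1 - (max ρ 0) ^ 2 := by
    have h1 : max ρ 0 < 1 := max_lt hρ one_pos
    have h2 : 0 ≤ max ρ 0 := le_max_right _ _
    nlinarith
  obtain ⟨B, hB0, hB⟩ := exists_Pk_le hδ
  have hb : ∀ᵐ p : ℂ × ℂ × ℝ ∂hypVol.prod (circleMeasure.prod (volume.restrict (Set.Ioi 0))),
      ‖p.2.1‖ = 1 :=
    Measure.quasiMeasurePreserving_snd.ae (Measure.quasiMeasurePreserving_fst.ae ae_circleMeasure)
  have hS : ∀ p : ℂ × ℂ × ℝ, a p.1 p.2.1 p.2.2 ≠ 0 →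
      1 - (max ρ 0) ^ 2 ≤ 1 - ‖p.1‖ ^ 2 ∧ p.2.2 ∈ Metric.closedBall (0 : ℝ) R := by
    intro p hp
    have hp : p ∈ tsupport fun p : ℂ × ℂ × ℝ => a p.1 p.2.1 p.2.2 := subset_tsupport _ hp
    have h1 : ‖p.1‖ < ρ := by simpa using h ⟨p, hp, rfl⟩
    refine ⟨?_, ?_⟩
    · gcongr
      exact h1.le.trans (le_max_left _ _)
    · rw [mem_closedBall_zero_iff]
      exact ((norm_snd_le p.2).trans (norm_snd_le p)).trans (hR p hp)
  have hP : Measurable fun p : ℂ × ℂ × ℝ => Pk p.1 p.2.1 :=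
    measurable_Pk.comp (g := fun q : ℂ × ℂ => Pk q.1 q.2)
      (f := fun p : ℂ × ℂ × ℝ => (p.1, p.2.1)) (by fun_prop)
  have hr : Measurable fun p : ℂ × ℂ × ℝ =>
      (2 * Real.pi)⁻¹ * p.2.2 * Real.tanh (Real.pi * p.2.2) :=
    (continuous_plancherelDensity.comp (f := fun p : ℂ × ℂ × ℝ => p.2.2) (by fun_prop)).measurable
  have hm : Measurable fun p : ℂ × ℂ × ℝ => ‖a p.1 p.2.1 p.2.2‖ ^ 2 * Pk p.1 p.2.1 *
      ((2 * Real.pi)⁻¹ * p.2.2 * Real.tanh (Real.pi * p.2.2)) :=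
    ((ha.measurable.norm.pow_const 2).mul hP).mul hr
  refine integrable_of_ae_bounded hm.aestronglyMeasurable
    ((measurableSet_one_sub_norm_sq (1 - (max ρ 0) ^ 2)).prod
      (MeasurableSet.univ.prod (measurableSet_closedBall (x := (0 : ℝ)) (ε := R)))) ?_
    (Filter.Eventually.of_forall fun p hp => ?_) (C := C ^ 2 * B * D) ?_
  · rw [Measure.prod_prod, Measure.prod_prod, measure_univ, one_mul]
    exact ENNReal.mul_ne_top (hypVol_one_sub_norm_sq_ne_top hδ)
      ((Measure.restrict_apply_le _ _).trans_lt
        (isCompact_closedBall (0 : ℝ) R).measure_lt_top).ne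
  · by_contra h0
    have h1 := hS p fun h => h0 (by simp [h])
    exact hp ⟨h1.1, Set.mem_univ _, h1.2⟩
  · filter_upwards [hb] with p hp
    have hC0 : 0 ≤ C := (norm_nonneg _).trans (hC 0)
    by_cases h0 : a p.1 p.2.1 p.2.2 = 0
    · have hD0 : 0 ≤ D := (norm_nonneg _).trans (hD 0 (by simpa using hR0.le))
      rw [h0, norm_zero, zero_pow two_ne_zero, zero_mul, zero_mul, norm_zero]
      positivity
    · have h1 := hS p h0
      rw [norm_mul, norm_mul, norm_pow, norm_norm]
      have h2 := (hB p.1 p.2.1 hp h1.1).1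
      rw [norm_real] at h2
      gcongr
      · exact hC p
      · exact hD _ h1.2

end Symbol

/-- Isometry property of the Wigner transform on the hyperbolic disc. -/
theorem wigner_transform_isometry
    (a : ℂ → ℂ → ℝ → ℂ)
    (hsm : ContDiff ℝ (⊤ : ℕ∞) fun p : ℂ × ℂ × ℝ => a p.1 p.2.1 p.2.2)
    (hcs : HasCompactSupport fun p : ℂ × ℂ × ℝ => a p.1 p.2.1 p.2.2)
    (hsupp : ∀ p ∈ tsupport (fun p : ℂ × ℂ × ℝ => a p.1 p.2.1 p.2.2), ‖p.1‖ < 1)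
    (hWeyl : ∀ z w : ℂ, ‖z‖ < 1 → ‖w‖ < 1 → ∀ r : ℝ,
      (∫ b, a z b r * (Pk z b : ℂ) ^ ((1 : ℂ) / 2 + Complex.I * (r : ℂ)) *
          (Pk w b : ℂ) ^ ((1 : ℂ) / 2 - Complex.I * (r : ℂ)) ∂circleMeasure) =
      ∫ b, a z b (-r) * (Pk z b : ℂ) ^ ((1 : ℂ) / 2 - Complex.I * (r : ℂ)) *
          (Pk w b : ℂ) ^ ((1 : ℂ) / 2 + Complex.I * (r : ℂ)) ∂circleMeasure)
    (Wa : ℝ → ℂ → ℝ → ℂ → ℂ)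
    (hWa : ∀ (r : ℝ) (b : ℂ) (r' : ℝ) (b' : ℂ), Wa r b r' b' =
      ∫ z, a z b r * (Pk z b : ℂ) ^ ((1 : ℂ) / 2 + Complex.I * (r : ℂ)) *
        (Pk z b' : ℂ) ^ ((1 : ℂ) / 2 + Complex.I * (r' : ℂ)) ∂hypVol) :
    (∫ z, (∫ b, (∫ r in Set.Ioi (0 : ℝ),
        ‖a z b r‖ ^ 2 * Pk z b * ((2 * Real.pi)⁻¹ * r * Real.tanh (Real.pi * r)))
      ∂circleMeasure) ∂hypVol) =
    ∫ b, (∫ r in Set.Ioi (0 : ℝ), (∫ b', (∫ r' in Set.Ioi (0 : ℝ),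
        ‖Wa r b r' b'‖ ^ 2 * ((2 * Real.pi)⁻¹ * r * Real.tanh (Real.pi * r)) *
          ((2 * Real.pi)⁻¹ * r' * Real.tanh (Real.pi * r')))
      ∂circleMeasure)) ∂circleMeasure := by
  have hT := integrable_norm_sq_mul_Pk hsm.continuous hcs hsupp
  have hinner : ∀ b, ‖b‖ = 1 → ∀ r : ℝ, (∫ b', (∫ r' in Set.Ioi (0 : ℝ),
        ‖Wa r b r' b'‖ ^ 2 * ((2 * Real.pi)⁻¹ * r * Real.tanh (Real.pi * r)) *
          ((2 * Real.pi)⁻¹ * r' * Real.tanh (Real.pi * r'))) ∂circleMeasure) =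
      ∫ z, ‖a z b r‖ ^ 2 * Pk z b * ((2 * Real.pi)⁻¹ * r * Real.tanh (Real.pi * r)) ∂hypVol := by
    intro b hb r
    have h := integral_integral_norm_hypFourier_sq
      (contDiff_slice hsm hsupp hb r ((1 : ℂ) / 2 + I * r)) (hasCompactSupport_slice hcs b r _)
      (fun z hz => mem_ball_zero_iff.mpr (hsupp _ (tsupport_slice_subset _ hz)))
    calc _ = (∫ b', (∫ r' in Set.Ioi (0 : ℝ),
          ‖hypFourier (fun z => a z b r * (Pk z b : ℂ) ^ ((1 : ℂ) / 2 + I * r)) r' b'‖ ^ 2 *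
            ((2 * Real.pi)⁻¹ * r' * Real.tanh (Real.pi * r'))) ∂circleMeasure) *
              ((2 * Real.pi)⁻¹ * r * Real.tanh (Real.pi * r)) := by
          simp_rw [← integral_mul_const, hWa, hypFourier, mul_right_comm]
      _ = _ := by
          rw [h, ← integral_mul_const]
          refine integral_congr_ae ?_
          filter_upwards [ae_hypVol] with z hz
          rw [norm_mul_Pk_cpow_sq hz hb]
  calc _ = ∫ z, ∫ q : ℂ × ℝ, ‖a z q.1 q.2‖ ^ 2 * Pk z q.1 *
        ((2 * Real.pi)⁻¹ * q.2 * Real.tanh (Real.pi * q.2))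
        ∂circleMeasure.prod (volume.restrict (Set.Ioi 0)) ∂hypVol := by
        refine integral_congr_ae ?_
        filter_upwards [hT.prod_right_ae] with z hi
        rw [integral_prod _ hi]
    _ = ∫ q : ℂ × ℝ, ∫ z, ‖a z q.1 q.2‖ ^ 2 * Pk z q.1 *
        ((2 * Real.pi)⁻¹ * q.2 * Real.tanh (Real.pi * q.2)) ∂hypVol
        ∂circleMeasure.prod (volume.restrict (Set.Ioi 0)) := integral_integral_swap hT
    _ = ∫ b, (∫ r in Set.Ioi (0 : ℝ), ∫ z, ‖a z b r‖ ^ 2 * Pk z b *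
        ((2 * Real.pi)⁻¹ * r * Real.tanh (Real.pi * r)) ∂hypVol) ∂circleMeasure :=
        integral_prod _ hT.integral_prod_right
    _ = _ := by
        refine integral_congr_ae ?_
        filter_upwards [ae_circleMeasure] with b hb
        simp only [hinner b hb]
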